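/- arXiv:2008.01234 — 4 statements merged into one kernel-verified Lean document; each statement's English description precedes it below -/
import Mathlib

section
/- In the algebra D~, for all m, n ∈ ℕ one has x2^{2m} * x21^{n} = Σ_{k=0}^{m} binom(m,k) * [n]^[k] * x21^{n+k} * x2^{2(m-k)}, where [n]^[k] is the raising factorial of the image of n in k. -/
/-!
The Hopf algebra `D~` (double of the super Jordan plane, bosonization stripped),
presented by generators x1, x2, u1, u2, g, g' (= g⁻¹), ζ and the relations
listed in the paper.  We realize it as `RingQuot` of the relation `Rel` on the
free algebra on 7 generators.
-/

namespace SuperJordanDouble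

variable (k : Type) [Field k]

noncomputable def fx1 : FreeAlgebra k (Fin 7) := FreeAlgebra.ι k 0
noncomputable def fx2 : FreeAlgebra k (Fin 7) := FreeAlgebra.ι k 1
noncomputable def fu1 : FreeAlgebra k (Fin 7) := FreeAlgebra.ι k 2
noncomputable def fu2 : FreeAlgebra k (Fin 7) := FreeAlgebra.ι k 3
noncomputable def fg  : FreeAlgebra k (Fin 7) := FreeAlgebra.ι k 4
noncomputable def fgi : FreeAlgebra k (Fin 7) := FreeAlgebra.ι k 5
noncomputable def fz  : FreeAlgebra k (Fin 7) := FreeAlgebra.ι k 6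
noncomputable def fx21 : FreeAlgebra k (Fin 7) := fx1 k * fx2 k + fx2 k * fx1 k
noncomputable def fu21 : FreeAlgebra k (Fin 7) := fu1 k * fu2 k + fu2 k * fu1 k

/-- The defining relations of `D~`. -/
inductive Rel : FreeAlgebra k (Fin 7) → FreeAlgebra k (Fin 7) → Prop
  | x1sq  : Rel (fx1 k * fx1 k) 0
  | x2x21 : Rel (fx2 k * fx21 k) (fx21 k * fx2 k + fx1 k * fx21 k)
  | u1sq  : Rel (fu1 k * fu1 k) 0
  | u2u21 : Rel (fu2 k * fu21 k) (fu21 k * fu2 k + fu1 k * fu21 k)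
  | ggi   : Rel (fg k * fgi k) 1
  | gig   : Rel (fgi k * fg k) 1
  | zg    : Rel (fz k * fg k) (fg k * fz k)
  | gx1   : Rel (fg k * fx1 k) (fx1 k * fg k)
  | gx2   : Rel (fg k * fx2 k) (fx2 k * fg k - fx1 k * fg k)
  | u1g   : Rel (fu1 k * fg k) (fg k * fu1 k)
  | u2g   : Rel (fu2 k * fg k) (fg k * fu2 k - fg k * fu1 k)
  | zx1   : Rel (fz k * fx1 k) (fx1 k * fz k + fx1 k)
  | zx2   : Rel (fz k * fx2 k) (fx2 k * fz k + fx2 k)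
  | u1z   : Rel (fu1 k * fz k) (fz k * fu1 k + fu1 k)
  | u2z   : Rel (fu2 k * fz k) (fz k * fu2 k + fu2 k)
  | u1x1  : Rel (fu1 k * fx1 k) (-(fx1 k * fu1 k))
  | u1x2  : Rel (fu1 k * fx2 k) (-(fx2 k * fu1 k) + 1 - fg k)
  | u2x1  : Rel (fu2 k * fx1 k) (-(fx1 k * fu2 k) + 1 - fg k + fx1 k * fu1 k)
  | u2x2  : Rel (fu2 k * fx2 k) (-(fx2 k * fu2 k) + fg k * fz k + fx2 k * fu1 k)

/-- The algebra `D~`. -/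
abbrev tD := RingQuot (Rel k)

noncomputable def x1 : tD k := RingQuot.mkAlgHom k (Rel k) (fx1 k)
noncomputable def x2 : tD k := RingQuot.mkAlgHom k (Rel k) (fx2 k)
noncomputable def u1 : tD k := RingQuot.mkAlgHom k (Rel k) (fu1 k)
noncomputable def u2 : tD k := RingQuot.mkAlgHom k (Rel k) (fu2 k)
noncomputable def g  : tD k := RingQuot.mkAlgHom k (Rel k) (fg k)
noncomputable def gi : tD k := RingQuot.mkAlgHom k (Rel k) (fgi k)
noncomputable def z  : tD k := RingQuot.mkAlgHom k (Rel k) (fz k)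
noncomputable def x21 : tD k := x1 k * x2 k + x2 k * x1 k
noncomputable def u21 : tD k := u1 k * u2 k + u2 k * u1 k

/-- `g^n` for `n : ℤ`, where negative powers are interpreted using `g' = g⁻¹`. -/
noncomputable def gpow (n : ℤ) : tD k :=
  if 0 ≤ n then g k ^ n.toNat else gi k ^ (-n).toNat

end SuperJordanDouble

open SuperJordanDouble

/-- The raising factorial `[a]^[n] = a(a+1)⋯(a+n-1)`. -/
def risingFactorial (k : Type) [Field k] (a : k) (n : ℕ) : k :=
  Finset.prod (Finset.range n) fun i => a + i

theorem risingFactorial_succ (k : Type) [Field k] (a : k) (i : ℕ) :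
    risingFactorial k a (i + 1) = a * risingFactorial k (a + 1) i := by
  unfold risingFactorial
  rw [Finset.prod_range_succ', mul_comm]
  push_cast
  rw [add_zero]
  congr 1
  exact Finset.prod_congr rfl fun _ _ => by ring

/-- If `A y = y A + y²`, then `A` acts on the powers of `y` as the derivation `y² d/dy`. -/
theorem mul_pow_of_mul_eq_add_sq {R : Type*} [Ring R] {A y : R}
    (h : A * y = y * A + y ^ 2) (n : ℕ) :
    A * y ^ n = y ^ n * A + n • y ^ (n + 1) := by
  induction n with
  | zero => simp
  | succ n ih =>
    rw [pow_succ, ← mul_assoc, ih, add_mul, mul_assoc, h, mul_add, ← mul_assoc, ← pow_add,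
      smul_mul_assoc, ← pow_succ, ← pow_succ, succ_nsmul', add_assoc]

theorem pow_mul_pow_of_mul_eq_add_sq (k : Type) [Field k] {R : Type*} [Ring R] [Algebra k R]
    {A y : R} (h : A * y = y * A + y ^ 2) (m n : ℕ) :
    A ^ m * y ^ n = ∑ i ∈ Finset.range (m + 1),
      m.choose i • risingFactorial k (n : k) i • (y ^ (n + i) * A ^ (m - i)) := by
  induction m generalizing n with
  | zero => simp [risingFactorial]
  | succ m ih =>
    rw [Finset.sum_choose_succ_nsmul
        (fun i j => risingFactorial k (n : k) i • (y ^ (n + i) * A ^ j)),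
      pow_succ, mul_assoc, mul_pow_of_mul_eq_add_sq h, mul_add, ← mul_assoc, ih,
      mul_smul_comm, ih, Finset.sum_mul, Finset.smul_sum]
    congr 1
    · refine Finset.sum_congr rfl fun i hi => ?_
      rw [smul_mul_assoc, smul_mul_assoc, mul_assoc, ← pow_succ,
        Nat.sub_add_comm (Finset.mem_range_succ_iff.mp hi)]
    · refine Finset.sum_congr rfl fun i _ => ?_
      rw [smul_comm, risingFactorial_succ, mul_smul, Nat.cast_smul_eq_nsmul, Nat.cast_succ,
        add_right_comm, add_assoc]

theorem x1_mul_x1 (k : Type) [Field k] : x1 k * x1 k = 0 := by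
  simpa [x1] using RingQuot.mkAlgHom_rel k (Rel.x1sq (k := k))

theorem x2_mul_x21 (k : Type) [Field k] :
    x2 k * x21 k = x21 k * x2 k + x1 k * x21 k := by
  simpa [x1, x2, x21, fx21] using RingQuot.mkAlgHom_rel k (Rel.x2x21 (k := k))

theorem x2_sq_mul_x21 (k : Type) [Field k] :
    x2 k ^ 2 * x21 k = x21 k * x2 k ^ 2 + x21 k ^ 2 := by
  have hx1 : x1 k * (x1 k * x21 k) = 0 := by rw [← mul_assoc, x1_mul_x1, zero_mul]
  calc x2 k ^ 2 * x21 k = x2 k * (x2 k * x21 k) := by rw [sq, mul_assoc]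
    _ = (x2 k * x21 k) * x2 k + x2 k * (x1 k * x21 k) := by
      rw [x2_mul_x21, mul_add, ← mul_assoc, x2_mul_x21]
    _ = x21 k * x2 k ^ 2 + x1 k * (x21 k * x2 k + x1 k * x21 k)
        + x2 k * (x1 k * x21 k) := by
      rw [mul_add, hx1, x2_mul_x21]
      noncomm_ring
    _ = x21 k * x2 k ^ 2 + (x1 k * x2 k + x2 k * x1 k) * x21 k := by
      rw [← x2_mul_x21]
      noncomm_ring
    _ = x21 k * x2 k ^ 2 + x21 k ^ 2 := by rw [sq (x21 k), ← x21]

/-- In `D~`,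
`x2^{2m} x21^{n} = Σ_{k'=0}^{m} binom(m,k') [n]^[k'] x21^{n+k'} x2^{2(m-k')}`. -/
theorem superJordanDouble_x2_pow_mul_x21_pow (k : Type) [Field k]
    (hchar : (2 : k) ≠ 0) (m n : ℕ) :
    x2 k ^ (2 * m) * x21 k ^ n =
      Finset.sum (Finset.range (m + 1)) fun i =>
        ((m.choose i : k) * risingFactorial k (n : k) i) •
          (x21 k ^ (n + i) * x2 k ^ (2 * (m - i))) := by
  rw [pow_mul, pow_mul_pow_of_mul_eq_add_sq k (x2_sq_mul_x21 k)]
  refine Finset.sum_congr rfl fun i _ => ?_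
  rw [pow_mul, mul_smul, Nat.cast_smul_eq_nsmul]
end

section
/- In the algebra D~, for all m, n ∈ ℕ one has ζ^{n} * x2^{m} = Σ_{ℓ=0}^{n} binom(n,ℓ) * m^{n-ℓ} * x2^{m} * ζ^{ℓ} and ζ^{n} * x21^{m} = Σ_{ℓ=0}^{n} binom(n,ℓ) * (2m)^{n-ℓ} * x21^{m} * ζ^{ℓ}, where m^{n-ℓ} and (2m)^{n-ℓ} are powers of the images of m and 2m in k. -/
open SuperJordanDouble

section WeightVectors

variable {k A : Type*} [CommSemiring k] [Semiring A] [Algebra k A]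

/-- If `ζ` acts on `x` by the commutator weight `c`, it acts on `x ^ m` by the weight `m * c`. -/
theorem mul_pow_of_mul_eq_add_smul {ζ x : A} {c : k} (h : ζ * x = x * ζ + c • x) (m : ℕ) :
    ζ * x ^ m = x ^ m * ζ + ((m : k) * c) • x ^ m := by
  induction m with
  | zero => simp
  | succ m ih =>
    calc ζ * x ^ (m + 1) = (ζ * x ^ m) * x := by rw [pow_succ, mul_assoc]
      _ = x ^ m * (ζ * x) + ((m : k) * c) • (x ^ m * x) := by
        rw [ih, add_mul, mul_assoc, smul_mul_assoc]
      _ = x ^ (m + 1) * ζ + (((m + 1 : ℕ) : k) * c) • x ^ (m + 1) := by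
        rw [h, mul_add, mul_smul_comm, ← mul_assoc, ← pow_succ, Nat.cast_succ, add_mul, one_mul,
          add_smul, add_assoc, add_comm (c • _)]

theorem pow_mul_of_mul_eq_add_smul {ζ y : A} {c : k} (h : ζ * y = y * ζ + c • y) (n : ℕ) :
    ζ ^ n * y =
      ∑ l ∈ Finset.range (n + 1), ((n.choose l : k) * c ^ (n - l)) • (y * ζ ^ l) := by
  have hs : SemiconjBy y (ζ + algebraMap k A c) ζ := by
    rw [SemiconjBy, h, mul_add, ← Algebra.commutes, ← Algebra.smul_def]
  rw [← (hs.pow_right n).eq, (Algebra.commute_algebraMap_right c ζ).add_pow, Finset.mul_sum]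
  refine Finset.sum_congr rfl fun l _ => ?_
  rw [← map_pow, ← map_natCast (algebraMap k A), mul_assoc, ← map_mul, ← Algebra.commutes,
    ← Algebra.smul_def, mul_smul_comm, mul_comm (c ^ _)]

end WeightVectors

theorem z_mul_x1 (k : Type) [Field k] : z k * x1 k = x1 k * z k + x1 k := by
  simpa [z, x1] using RingQuot.mkAlgHom_rel k (Rel.zx1 (k := k))

theorem z_mul_x2 (k : Type) [Field k] : z k * x2 k = x2 k * z k + x2 k := by
  simpa [z, x2] using RingQuot.mkAlgHom_rel k (Rel.zx2 (k := k))

theorem z_mul_x21 (k : Type) [Field k] :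
    z k * x21 k = x21 k * z k + (2 : k) • x21 k := by
  have h₁ := z_mul_x1 k
  have h₂ := z_mul_x2 k
  calc z k * x21 k = (z k * x1 k) * x2 k + (z k * x2 k) * x1 k := by
        simp only [x21, mul_add, mul_assoc]
    _ = x1 k * (z k * x2 k) + x1 k * x2 k + (x2 k * (z k * x1 k) + x2 k * x1 k) := by
        simp only [← mul_assoc, ← add_mul, ← h₁, ← h₂]
    _ = x21 k * z k + (2 : k) • x21 k := by
        rw [h₁, h₂, two_smul, x21]
        noncomm_ring

/-- In `D~`,
`ζ^{n} x2^{m} = Σ_{ℓ=0}^{n} binom(n,ℓ) m^{n-ℓ} x2^{m} ζ^{ℓ}` and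
`ζ^{n} x21^{m} = Σ_{ℓ=0}^{n} binom(n,ℓ) (2m)^{n-ℓ} x21^{m} ζ^{ℓ}`. -/
theorem superJordanDouble_zeta_pow_mul (k : Type) [Field k]
    (hchar : (2 : k) ≠ 0) (m n : ℕ) :
    (z k ^ n * x2 k ^ m =
      Finset.sum (Finset.range (n + 1)) fun l =>
        ((n.choose l : k) * (m : k) ^ (n - l)) • (x2 k ^ m * z k ^ l)) ∧
    (z k ^ n * x21 k ^ m =
      Finset.sum (Finset.range (n + 1)) fun l =>
        ((n.choose l : k) * ((2 * m : ℕ) : k) ^ (n - l)) • (x21 k ^ m * z k ^ l)) := by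
  have h₂ : z k * x2 k = x2 k * z k + (1 : k) • x2 k := by rw [one_smul, z_mul_x2]
  refine ⟨pow_mul_of_mul_eq_add_smul ?_ n, pow_mul_of_mul_eq_add_smul ?_ n⟩
  · simpa using mul_pow_of_mul_eq_add_smul h₂ m
  · rw [mul_pow_of_mul_eq_add_smul (z_mul_x21 k) m, Nat.cast_mul, Nat.cast_ofNat, mul_comm (2 : k)]
end

section
/- The six elements x21^p, x2^{2p}, u21^p, u2^{2p}, g^p, ζ^p - ζ lie in the center of the algebra D~. -/
namespace SuperJordanDouble

section Ad

attribute [local instance] LieRing.ofAssociativeRing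

variable {k A : Type*} [Field k] [Ring A] [Algebra k A]

theorem lie_mul_leibniz (a b c : A) : ⁅a, b * c⁆ = ⁅a, b⁆ * c + b * ⁅a, c⁆ := by
  simp only [Ring.lie_def]
  noncomm_ring

/-- In characteristic `p`, `ad (a ^ p) = (ad a) ^ p`. -/
theorem lie_pow_char (p : ℕ) [Fact p.Prime] [CharP k p] (a b : A) :
    ⁅a ^ p, b⁆ = (LieAlgebra.ad k A a ^ p) b := by
  cases subsingleton_or_nontrivial A
  · exact Subsingleton.elim _ _
  have : CharP (Module.End k A) p :=
    charP_of_injective_algebraMap (algebraMap k (Module.End k A)).injective p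
  rw [LieAlgebra.ad_eq_lmul_left_sub_lmul_right, Pi.sub_apply,
    sub_pow_char_of_commute p (LinearMap.commute_mulLeft_right a a),
    LinearMap.pow_mulLeft, LinearMap.pow_mulRight, Ring.lie_def]
  rfl

theorem commute_pow_char_of_ad_pow_eq_zero (p : ℕ) [Fact p.Prime] [CharP k p] {a b : A} {n : ℕ}
    (hn : n ≤ p) (h : (LieAlgebra.ad k A a ^ n) b = 0) : Commute (a ^ p) b := by
  rw [commute_iff_lie_eq, lie_pow_char (k := k), ← Nat.sub_add_cancel hn, pow_add,
    Module.End.mul_apply, h, map_zero]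

variable (k) in
theorem commute_pow_char_of_lie_lie_lie_eq_zero (p : ℕ) [Fact p.Prime] [CharP k p] (hp : 2 < p)
    {a b : A} (h : ⁅a, ⁅a, ⁅a, b⁆⁆⁆ = 0) : Commute (a ^ p) b :=
  commute_pow_char_of_ad_pow_eq_zero (k := k) p (n := 3) hp (by simpa [pow_succ] using h)

variable (k) in
theorem commute_pow_char_of_lie_lie_eq_zero (p : ℕ) [Fact p.Prime] [CharP k p] (hp : 2 < p)
    {a b : A} (h : ⁅a, ⁅a, b⁆⁆ = 0) : Commute (a ^ p) b :=
  commute_pow_char_of_lie_lie_lie_eq_zero k p hp (by rw [h, lie_zero])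

theorem lie_pow_of_lie_eq_sq {a t : A} (h : ⁅a, t⁆ = t ^ 2) (n : ℕ) :
    ⁅a, t ^ n⁆ = n • t ^ (n + 1) := by
  induction n with
  | zero => simp [Ring.lie_def]
  | succ n ih =>
    rw [pow_succ, lie_mul_leibniz, ih, h, smul_mul_assoc, ← pow_succ, ← pow_add, succ_nsmul]

theorem ad_pow_of_lie_eq_nsmul {a t b : A} {m : ℕ} (ht : ⁅a, t⁆ = t ^ 2)
    (hb : ⁅a, b⁆ = m • (t * b)) (n : ℕ) :
    (LieAlgebra.ad k A a ^ n) b = m.ascFactorial n • (t ^ n * b) := by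
  induction n with
  | zero => simp
  | succ n ih =>
    rw [pow_succ', Module.End.mul_apply, ih, LieAlgebra.ad_apply, lie_nsmul, lie_mul_leibniz,
      lie_pow_of_lie_eq_sq ht, hb, mul_smul_comm, smul_mul_assoc, ← mul_assoc, ← pow_succ,
      ← add_smul, smul_smul, Nat.ascFactorial_succ]
    ring_nf

theorem ad_pow_mul_of_lie_eq_zero {a c : A} (h : ⁅a, c⁆ = 0) (b : A) (n : ℕ) :
    (LieAlgebra.ad k A a ^ n) (c * b) = c * (LieAlgebra.ad k A a ^ n) b := by
  induction n with
  | zero => simp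
  | succ n ih =>
    simp only [pow_succ', Module.End.mul_apply, ih, LieAlgebra.ad_apply, lie_mul_leibniz, h,
      zero_mul, zero_add]

theorem ad_pow_succ_mul_of_lie_lie_eq_zero {a c : A} (h : ⁅a, ⁅a, c⁆⁆ = 0) (b : A) (n : ℕ) :
    (LieAlgebra.ad k A a ^ (n + 1)) (b * c) =
      (LieAlgebra.ad k A a ^ (n + 1)) b * c +
        (n + 1) • ((LieAlgebra.ad k A a ^ n) b * ⁅a, c⁆) := by
  induction n with
  | zero => simp [lie_mul_leibniz]
  | succ n ih =>
    rw [pow_succ', Module.End.mul_apply, ih]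
    simp only [pow_succ', Module.End.mul_apply, LieAlgebra.ad_apply, lie_add, lie_nsmul, lie_mul_leibniz, h,
      mul_zero, add_zero, add_assoc, add_smul, one_smul]
    abel

variable (k) in
theorem nsmul_eq_zero_of_char_dvd (p : ℕ) [CharP k p] {m : ℕ} (h : p ∣ m) (a : A) : m • a = 0 := by
  rw [← Nat.cast_smul_eq_nsmul k, (CharP.cast_eq_zero_iff k p m).2 h, zero_smul]

variable (k) in
theorem commute_pow_char_of_lie_eq_mul (p : ℕ) [hp : Fact p.Prime] [CharP k p] {a t b : A}
    (ht : ⁅a, t⁆ = t ^ 2) (hb : ⁅a, b⁆ = t * b) : Commute (a ^ p) b := by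
  refine commute_pow_char_of_ad_pow_eq_zero (k := k) p le_rfl ?_
  rw [ad_pow_of_lie_eq_nsmul ht (m := 1) (by rw [hb, one_smul]), Nat.one_ascFactorial]
  exact nsmul_eq_zero_of_char_dvd k p (Nat.dvd_factorial hp.out.pos le_rfl) _

theorem ad_pow_eq_zero_of_lie_eq_two_nsmul (p : ℕ) [hp : Fact p.Prime] [CharP k p] {a t b : A}
    (ht : ⁅a, t⁆ = t ^ 2) (hb : ⁅a, b⁆ = 2 • (t * b)) {n : ℕ} (hn : n + 1 = p) :
    (LieAlgebra.ad k A a ^ n) b = 0 := by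
  have hfac := Nat.factorial_mul_ascFactorial 1 n
  rw [Nat.factorial_one, one_mul, add_comm 1 n, hn] at hfac
  rw [ad_pow_of_lie_eq_nsmul ht hb, hfac]
  exact nsmul_eq_zero_of_char_dvd k p (Nat.dvd_factorial hp.out.pos le_rfl) _

theorem ad_pow_of_lie_eq_smul {a b : A} {c : k} (h : ⁅a, b⁆ = c • b) (n : ℕ) :
    (LieAlgebra.ad k A a ^ n) b = c ^ n • b := by
  induction n with
  | zero => simp
  | succ n ih =>
    rw [pow_succ', Module.End.mul_apply, ih, map_smul, LieAlgebra.ad_apply, h, smul_smul,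
      ← pow_succ]

theorem commute_pow_char_sub_self_of_lie_eq_smul (p : ℕ) [Fact p.Prime] [CharP k p] {a b : A}
    {c : k} (hc : c ^ p = c) (h : ⁅a, b⁆ = c • b) : Commute (a ^ p - a) b := by
  rw [commute_iff_lie_eq, sub_lie, lie_pow_char (k := k), ad_pow_of_lie_eq_smul h, h, hc, sub_self]

end Ad

/-- The relations of `D~`, oriented towards the monomial order `x₁, x₂, g, z, u₁, u₂`. -/
structure Relations {A : Type*} [Ring A] (x₁ x₂ u₁ u₂ g z : A) : Prop where
  x₁_x₁ : x₁ * x₁ = 0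
  x₂_x₂_x₁ : x₂ * (x₂ * x₁) = x₁ * (x₂ * x₂) + x₁ * (x₂ * x₁)
  u₁_u₁ : u₁ * u₁ = 0
  u₂_u₂_u₁ : u₂ * (u₂ * u₁) = u₁ * (u₂ * u₂) + u₁ * (u₂ * u₁)
  z_g : z * g = g * z
  g_x₁ : g * x₁ = x₁ * g
  g_x₂ : g * x₂ = x₂ * g - x₁ * g
  u₁_g : u₁ * g = g * u₁
  u₂_g : u₂ * g = g * u₂ - g * u₁
  z_x₁ : z * x₁ = x₁ * z + x₁
  z_x₂ : z * x₂ = x₂ * z + x₂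
  u₁_z : u₁ * z = z * u₁ + u₁
  u₂_z : u₂ * z = z * u₂ + u₂
  u₁_x₁ : u₁ * x₁ = -(x₁ * u₁)
  u₁_x₂ : u₁ * x₂ = -(x₂ * u₁) + 1 - g
  u₂_x₁ : u₂ * x₁ = -(x₁ * u₂) + 1 - g + x₁ * u₁
  u₂_x₂ : u₂ * x₂ = -(x₂ * u₂) + g * z + x₂ * u₁

namespace Relations

variable {A : Type*} [Ring A] {x₁ x₂ u₁ u₂ g z : A}

/-- The relations together with their right multiples, as a terminating rewriting system on
right-associated monomials. -/
theorem rewriting (h : Relations x₁ x₂ u₁ u₂ g z) :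
    (x₁ * x₁ = 0 ∧ x₂ * (x₂ * x₁) = x₁ * (x₂ * x₂) + x₁ * (x₂ * x₁) ∧
      u₁ * u₁ = 0 ∧ u₂ * (u₂ * u₁) = u₁ * (u₂ * u₂) + u₁ * (u₂ * u₁) ∧
      z * g = g * z ∧ g * x₁ = x₁ * g ∧ g * x₂ = x₂ * g - x₁ * g ∧
      u₁ * g = g * u₁ ∧ u₂ * g = g * u₂ - g * u₁ ∧
      z * x₁ = x₁ * z + x₁ ∧ z * x₂ = x₂ * z + x₂ ∧
      u₁ * z = z * u₁ + u₁ ∧ u₂ * z = z * u₂ + u₂ ∧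
      u₁ * x₁ = -(x₁ * u₁) ∧ u₁ * x₂ = -(x₂ * u₁) + 1 - g ∧
      u₂ * x₁ = -(x₁ * u₂) + 1 - g + x₁ * u₁ ∧
      u₂ * x₂ = -(x₂ * u₂) + g * z + x₂ * u₁) ∧
    ∀ w : A, x₁ * (x₁ * w) = 0 ∧
      x₂ * (x₂ * (x₁ * w)) = (x₁ * (x₂ * x₂) + x₁ * (x₂ * x₁)) * w ∧
      u₁ * (u₁ * w) = 0 ∧
      u₂ * (u₂ * (u₁ * w)) = (u₁ * (u₂ * u₂) + u₁ * (u₂ * u₁)) * w ∧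
      z * (g * w) = g * z * w ∧ g * (x₁ * w) = x₁ * g * w ∧
      g * (x₂ * w) = (x₂ * g - x₁ * g) * w ∧
      u₁ * (g * w) = g * u₁ * w ∧ u₂ * (g * w) = (g * u₂ - g * u₁) * w ∧
      z * (x₁ * w) = (x₁ * z + x₁) * w ∧ z * (x₂ * w) = (x₂ * z + x₂) * w ∧
      u₁ * (z * w) = (z * u₁ + u₁) * w ∧ u₂ * (z * w) = (z * u₂ + u₂) * w ∧
      u₁ * (x₁ * w) = -(x₁ * u₁) * w ∧ u₁ * (x₂ * w) = (-(x₂ * u₁) + 1 - g) * w ∧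
      u₂ * (x₁ * w) = (-(x₁ * u₂) + 1 - g + x₁ * u₁) * w ∧
      u₂ * (x₂ * w) = (-(x₂ * u₂) + g * z + x₂ * u₁) * w := by
  obtain ⟨h₁, h₂, h₃, h₄, h₅, h₆, h₇, h₈, h₉, h₁₀, h₁₁, h₁₂, h₁₃, h₁₄, h₁₅, h₁₆, h₁₇⟩ := h
  refine ⟨by simp only [*, and_self], fun w ↦ ?_⟩
  simp only [← mul_assoc] at h₂ h₄ ⊢
  simp only [*, zero_mul, and_self]

section Brackets

set_option linter.unusedSimpArgs false

theorem lie_lie_x₂₁ (h : Relations x₁ x₂ u₁ u₂ g z) :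
    let t := x₁ * x₂ + x₂ * x₁
    ⁅t, ⁅t, x₁⁆⁆ = 0 ∧ ⁅t, ⁅t, x₂⁆⁆ = 0 ∧ ⁅t, ⁅t, u₁⁆⁆ = 0 ∧ ⁅t, ⁅t, u₂⁆⁆ = 0 ∧
      ⁅t, ⁅t, g⁆⁆ = 0 ∧ ⁅t, ⁅t, z⁆⁆ = 0 := by
  refine ⟨?_, ?_, ?_, ?_, ?_, ?_⟩ <;>
  · simp only [Ring.lie_def, h.rewriting, mul_add, add_mul, mul_sub, sub_mul, mul_assoc, neg_mul,
      mul_neg, mul_one, one_mul, mul_zero, zero_mul, neg_neg]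
    abel

theorem lie_lie_u₂₁ (h : Relations x₁ x₂ u₁ u₂ g z) :
    let s := u₁ * u₂ + u₂ * u₁
    ⁅s, ⁅s, x₁⁆⁆ = 0 ∧ ⁅s, ⁅s, x₂⁆⁆ = 0 ∧ ⁅s, ⁅s, u₁⁆⁆ = 0 ∧ ⁅s, ⁅s, u₂⁆⁆ = 0 ∧
      ⁅s, ⁅s, g⁆⁆ = 0 ∧ ⁅s, ⁅s, z⁆⁆ = 0 := by
  refine ⟨?_, ?_, ?_, ?_, ?_, ?_⟩ <;>
  · simp only [Ring.lie_def, h.rewriting, mul_add, add_mul, mul_sub, sub_mul, mul_assoc, neg_mul,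
      mul_neg, mul_one, one_mul, mul_zero, zero_mul, neg_neg]
    abel

theorem lie_lie_g (h : Relations x₁ x₂ u₁ u₂ g z) :
    ⁅g, ⁅g, x₁⁆⁆ = 0 ∧ ⁅g, ⁅g, x₂⁆⁆ = 0 ∧ ⁅g, ⁅g, u₁⁆⁆ = 0 ∧ ⁅g, ⁅g, u₂⁆⁆ = 0 ∧
      ⁅g, ⁅g, z⁆⁆ = 0 := by
  refine ⟨?_, ?_, ?_, ?_, ?_⟩ <;>
  · simp only [Ring.lie_def, h.rewriting, mul_add, add_mul, mul_sub, sub_mul, mul_assoc, neg_mul,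
      mul_neg, mul_one, one_mul, mul_zero, zero_mul, neg_neg]
    abel

theorem lie_x₂_sq (h : Relations x₁ x₂ u₁ u₂ g z) :
    let t := x₁ * x₂ + x₂ * x₁
    ⁅x₂ ^ 2, t⁆ = t ^ 2 ∧ ⁅x₂ ^ 2, x₁⁆ = t * x₁ ∧ ⁅x₂ ^ 2, g⁆ = t * g ∧
      ⁅x₂ ^ 2, x₁ * g⁆ = 2 • (t * (x₁ * g)) ∧ ⁅x₂ ^ 2, z⁆ = -2 • x₂ ^ 2 ∧
      ⁅x₂ ^ 2, u₁⁆ = -(x₁ * g) ∧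
      ⁅x₂ ^ 2, u₂⁆ = x₂ ^ 2 * 2 • u₁ + x₁ * g * z + x₁ * g - x₂ := by
  refine ⟨?_, ?_, ?_, ?_, ?_, ?_, ?_⟩ <;>
  · simp only [Ring.lie_def, h.rewriting, mul_add, add_mul, mul_sub, sub_mul, mul_assoc, neg_mul,
      mul_neg, mul_one, one_mul, mul_zero, zero_mul, neg_neg, pow_two, two_smul]
    abel

theorem lie_u₂_sq (h : Relations x₁ x₂ u₁ u₂ g z) :
    let s := u₁ * u₂ + u₂ * u₁
    ⁅u₂ ^ 2, x₁⁆ = u₁ - x₁ * s ∧ ⁅u₂ ^ 2, x₂⁆ = g * (u₂ - u₁) - x₂ * s ∧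
      ⁅u₂ ^ 2, ⁅u₂ ^ 2, g⁆⁆ = 0 ∧ ⁅u₂ ^ 2, ⁅u₂ ^ 2, z⁆⁆ = 0 ∧
      ⁅u₂ ^ 2, u₁⁆ = s * u₁ ∧ ⁅u₂ ^ 2, s⁆ = s ^ 2 ∧
      ⁅u₂ ^ 2, u₁ - x₁ * s⁆ = 0 ∧ ⁅u₂ ^ 2, g * (u₂ - u₁) - x₂ * s⁆ = -2 • (g * s * u₂) ∧
      ⁅u₂ ^ 2, g * s * u₂⁆ = 0 := by
  refine ⟨?_, ?_, ?_, ?_, ?_, ?_, ?_, ?_, ?_⟩ <;>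
  · simp only [Ring.lie_def, h.rewriting, mul_add, add_mul, mul_sub, sub_mul, mul_assoc, neg_mul,
      mul_neg, mul_one, one_mul, mul_zero, zero_mul, neg_neg, pow_two]
    abel

end Brackets

section Commute

attribute [local instance] LieRing.ofAssociativeRing

theorem ad_x₂_sq_pow_u₂ {k : Type*} [Field k] [Algebra k A] (p : ℕ) [hp : Fact p.Prime] [CharP k p]
    (h : Relations x₁ x₂ u₁ u₂ g z) : (LieAlgebra.ad k A (x₂ ^ 2) ^ p) u₂ = 0 := by
  obtain ⟨ht, -, -, hw, hz, hu₁, hu₂⟩ := h.lie_x₂_sq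
  obtain ⟨n, rfl⟩ := Nat.exists_eq_add_of_le' hp.out.two_le
  set D := LieAlgebra.ad k A (x₂ ^ 2)
  have hwD : (D ^ (n + 1)) (x₁ * g) = 0 := ad_pow_eq_zero_of_lie_eq_two_nsmul (n + 2) ht hw rfl
  have hzD : (D ^ (n + 1)) (x₁ * g * z) = 2 • ((D ^ n) (x₁ * g) * x₂ ^ 2) := by
    have hp0 := nsmul_eq_zero_of_char_dvd k (n + 2) dvd_rfl ((D ^ n) (x₁ * g) * ⁅x₂ ^ 2, z⁆)
    rw [succ_nsmul] at hp0
    rw [ad_pow_succ_mul_of_lie_lie_eq_zero (by rw [hz, lie_zsmul, lie_self, smul_zero]), hwD,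
      zero_mul, zero_add, eq_neg_of_add_eq_zero_left hp0, hz]
    noncomm_ring
  have hu₁D : (D ^ (n + 1)) (x₂ ^ 2 * 2 • u₁) = -(2 • (x₂ ^ 2 * (D ^ n) (x₁ * g))) := by
    rw [ad_pow_mul_of_lie_eq_zero (lie_self _), map_nsmul, pow_succ D, Module.End.mul_apply,
      LieAlgebra.ad_apply, hu₁, map_neg, smul_neg, mul_neg, mul_smul_comm]
  have hx₂D : (D ^ (n + 1)) x₂ = 0 := by
    rw [pow_succ, Module.End.mul_apply, LieAlgebra.ad_apply, Ring.lie_def, ← pow_succ, ← pow_succ',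
      sub_self, map_zero]
  have hcomm : x₂ ^ 2 * (D ^ n) (x₁ * g) - (D ^ n) (x₁ * g) * x₂ ^ 2 = 0 := by
    rw [← hwD, pow_succ' D, Module.End.mul_apply]
    rfl
  rw [pow_succ, Module.End.mul_apply, LieAlgebra.ad_apply, hu₂, map_sub, map_add, map_add, hwD,
    hzD, hu₁D, hx₂D, sub_eq_zero.1 hcomm, neg_add_cancel, add_zero, sub_zero]

theorem commute_x₂_sq_pow (k : Type*) [Field k] [Algebra k A] (p : ℕ) [hp : Fact p.Prime] [CharP k p]
    (h : Relations x₁ x₂ u₁ u₂ g z) :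
    Commute ((x₂ ^ 2) ^ p) x₁ ∧ Commute ((x₂ ^ 2) ^ p) x₂ ∧ Commute ((x₂ ^ 2) ^ p) u₁ ∧
      Commute ((x₂ ^ 2) ^ p) u₂ ∧ Commute ((x₂ ^ 2) ^ p) g ∧ Commute ((x₂ ^ 2) ^ p) z := by
  obtain ⟨ht, hx₁, hg, hw, hz, hu₁, -⟩ := h.lie_x₂_sq
  obtain ⟨n, hn⟩ := Nat.exists_eq_add_of_le' hp.out.one_le
  refine ⟨commute_pow_char_of_lie_eq_mul k p ht hx₁, ((Commute.refl x₂).pow_left 2).pow_left p,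
    commute_pow_char_of_ad_pow_eq_zero (k := k) p le_rfl ?_,
    commute_pow_char_of_ad_pow_eq_zero (k := k) p le_rfl (h.ad_x₂_sq_pow_u₂ p),
    commute_pow_char_of_lie_eq_mul k p ht hg,
    commute_pow_char_of_ad_pow_eq_zero (k := k) p (n := 2) hp.out.two_le ?_⟩
  · rw [hn, pow_succ, Module.End.mul_apply, LieAlgebra.ad_apply, hu₁, map_neg,
      ad_pow_eq_zero_of_lie_eq_two_nsmul p ht hw hn.symm, neg_zero]
  · rw [pow_two (LieAlgebra.ad k A _), Module.End.mul_apply, LieAlgebra.ad_apply,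
      LieAlgebra.ad_apply, hz, lie_zsmul, lie_self, smul_zero]

theorem commute_u₂_sq_pow (k : Type*) [Field k] [Algebra k A] (p : ℕ) [hp : Fact p.Prime] [CharP k p]
    (h : Relations x₁ x₂ u₁ u₂ g z) (hp2 : 2 < p) :
    Commute ((u₂ ^ 2) ^ p) x₁ ∧ Commute ((u₂ ^ 2) ^ p) x₂ ∧ Commute ((u₂ ^ 2) ^ p) u₁ ∧
      Commute ((u₂ ^ 2) ^ p) u₂ ∧ Commute ((u₂ ^ 2) ^ p) g ∧ Commute ((u₂ ^ 2) ^ p) z := by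
  obtain ⟨hx₁, hx₂, hg, hz, hu₁, hs, hx₁', hx₂', hx₂''⟩ := h.lie_u₂_sq
  exact ⟨commute_pow_char_of_lie_lie_eq_zero k p hp2 (by rw [hx₁, hx₁']),
    commute_pow_char_of_lie_lie_lie_eq_zero k p hp2
      (by rw [hx₂, hx₂', lie_zsmul, hx₂'', smul_zero]),
    commute_pow_char_of_lie_eq_mul k p hs hu₁, ((Commute.refl u₂).pow_left 2).pow_left p,
    commute_pow_char_of_lie_lie_eq_zero k p hp2 hg, commute_pow_char_of_lie_lie_eq_zero k p hp2 hz⟩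

theorem commute_z_pow_sub_z (k : Type*) [Field k] [Algebra k A] (p : ℕ) [hp : Fact p.Prime] [CharP k p]
    (h : Relations x₁ x₂ u₁ u₂ g z) (hp2 : 2 < p) :
    Commute (z ^ p - z) x₁ ∧ Commute (z ^ p - z) x₂ ∧ Commute (z ^ p - z) u₁ ∧
      Commute (z ^ p - z) u₂ ∧ Commute (z ^ p - z) g ∧ Commute (z ^ p - z) z := by
  have hneg : (-1 : k) ^ p = -1 := (hp.out.odd_of_ne_two hp2.ne').neg_one_pow
  have hcomm {b : A} (hb : Commute z b) : Commute (z ^ p - z) b := (hb.pow_left p).sub_left hb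
  refine ⟨commute_pow_char_sub_self_of_lie_eq_smul p (one_pow p : (1 : k) ^ p = 1) ?_,
    commute_pow_char_sub_self_of_lie_eq_smul p (one_pow p : (1 : k) ^ p = 1) ?_,
    commute_pow_char_sub_self_of_lie_eq_smul p hneg ?_,
    commute_pow_char_sub_self_of_lie_eq_smul p hneg ?_, hcomm h.z_g, hcomm (Commute.refl z)⟩ <;>
  simp [Ring.lie_def, h.z_x₁, h.z_x₂, h.u₁_z, h.u₂_z]

end Commute

end Relations

section Presentation

theorem mul_mul_eq_of_mul_anticommutator {A : Type*} [Ring A] {a b : A} (ha : a * a = 0)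
    (h : b * (a * b + b * a) = (a * b + b * a) * b + a * (a * b + b * a)) :
    b * (b * a) = a * (b * b) + a * (b * a) := by
  have haab : a * (a * b) = 0 := by rw [← mul_assoc, ha, zero_mul]
  simp only [mul_add, add_mul, mul_assoc, haab, zero_add] at h
  rw [add_comm (b * (a * b)), add_right_comm] at h
  exact add_right_cancel h

variable (k : Type) [Field k]

theorem relations : Relations (x1 k) (x2 k) (u1 k) (u2 k) (g k) (z k) := by
  unfold x1 x2 u1 u2 g z
  have hrel {a b : FreeAlgebra k (Fin 7)} (hab : Rel k a b) := RingQuot.mkAlgHom_rel k hab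
  have hx := hrel .x1sq
  have hu := hrel .u1sq
  rw [map_mul, map_zero] at hx hu
  constructor
  case x₁_x₁ => exact hx
  case u₁_u₁ => exact hu
  case x₂_x₂_x₁ =>
    exact mul_mul_eq_of_mul_anticommutator hx
      (by simpa only [fx21, map_mul, map_add] using hrel .x2x21)
  case u₂_u₂_u₁ =>
    exact mul_mul_eq_of_mul_anticommutator hu
      (by simpa only [fu21, map_mul, map_add] using hrel .u2u21)
  case z_g => simpa only [map_mul] using hrel .zg
  case g_x₁ => simpa only [map_mul] using hrel .gx1
  case g_x₂ => simpa only [map_mul, map_sub] using hrel .gx2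
  case u₁_g => simpa only [map_mul] using hrel .u1g
  case u₂_g => simpa only [map_mul, map_sub] using hrel .u2g
  case z_x₁ => simpa only [map_mul, map_add] using hrel .zx1
  case z_x₂ => simpa only [map_mul, map_add] using hrel .zx2
  case u₁_z => simpa only [map_mul, map_add] using hrel .u1z
  case u₂_z => simpa only [map_mul, map_add] using hrel .u2z
  case u₁_x₁ => simpa only [map_mul, map_neg] using hrel .u1x1
  case u₁_x₂ => simpa only [map_mul, map_add, map_sub, map_neg, map_one] using hrel .u1x2
  case u₂_x₁ => simpa only [map_mul, map_add, map_sub, map_neg, map_one] using hrel .u2x1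
  case u₂_x₂ => simpa only [map_mul, map_add, map_neg] using hrel .u2x2

variable {k}

theorem mem_center_of_commute {a : tD k} (h : Commute a (x1 k) ∧ Commute a (x2 k) ∧
    Commute a (u1 k) ∧ Commute a (u2 k) ∧ Commute a (g k) ∧ Commute a (z k)) :
    a ∈ Subalgebra.center k (tD k) := by
  obtain ⟨hx1, hx2, hu1, hu2, hg, hz⟩ := h
  have hggi : g k * gi k = 1 := by
    simpa only [g, gi, map_mul, map_one] using RingQuot.mkAlgHom_rel k (Rel.ggi (k := k))
  have higg : gi k * g k = 1 := by
    simpa only [g, gi, map_mul, map_one] using RingQuot.mkAlgHom_rel k (Rel.gig (k := k))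
  have hgi : Commute a (gi k) :=
    Commute.units_inv_right (u := ⟨g k, gi k, hggi, higg⟩) hg
  rw [Subalgebra.mem_center_iff]
  intro b
  obtain ⟨b, rfl⟩ := RingQuot.mkAlgHom_surjective k (Rel k) b
  change Commute _ a
  symm
  induction b using FreeAlgebra.induction with
  | grade0 r =>
    rw [AlgHom.commutes]
    exact Algebra.commute_algebraMap_right r a
  | grade1 i => fin_cases i <;> assumption
  | mul b c hb hc =>
    rw [map_mul]
    exact hb.mul_right hc
  | add b c hb hc =>
    rw [map_add]
    exact hb.add_right hc

end Presentation

end SuperJordanDouble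

open SuperJordanDouble

/-- If `char k = p > 2` is prime, then the six elements
`x21^p, x2^{2p}, u21^p, u2^{2p}, g^p, ζ^p - ζ` are central in `D~`. -/
theorem superJordanDouble_central_elements (p : ℕ) (hp : p.Prime) (hp2 : 2 < p)
    (k : Type) [Field k] [CharP k p] :
    x21 k ^ p ∈ Subalgebra.center k (tD k) ∧
    x2 k ^ (2 * p) ∈ Subalgebra.center k (tD k) ∧
    u21 k ^ p ∈ Subalgebra.center k (tD k) ∧
    u2 k ^ (2 * p) ∈ Subalgebra.center k (tD k) ∧
    g k ^ p ∈ Subalgebra.center k (tD k) ∧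
    z k ^ p - z k ∈ Subalgebra.center k (tD k) := by
  have : Fact p.Prime := ⟨hp⟩
  have h := relations k
  have hpow {a b : tD k} (hab : ⁅a, ⁅a, b⁆⁆ = 0) : Commute (a ^ p) b :=
    commute_pow_char_of_lie_lie_eq_zero k p hp2 hab
  refine ⟨mem_center_of_commute ?_, mem_center_of_commute ?_, mem_center_of_commute ?_,
    mem_center_of_commute ?_, mem_center_of_commute ?_, mem_center_of_commute ?_⟩
  · obtain ⟨h₁, h₂, h₃, h₄, h₅, h₆⟩ := h.lie_lie_x₂₁
    exact ⟨hpow h₁, hpow h₂, hpow h₃, hpow h₄, hpow h₅, hpow h₆⟩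
  · rw [pow_mul]
    exact h.commute_x₂_sq_pow k p
  · obtain ⟨h₁, h₂, h₃, h₄, h₅, h₆⟩ := h.lie_lie_u₂₁
    exact ⟨hpow h₁, hpow h₂, hpow h₃, hpow h₄, hpow h₅, hpow h₆⟩
  · rw [pow_mul]
    exact h.commute_u₂_sq_pow k p hp2
  · obtain ⟨h₁, h₂, h₃, h₄, h₅⟩ := h.lie_lie_g
    exact ⟨hpow h₁, hpow h₂, hpow h₃, hpow h₄, Commute.pow_self _ p, hpow h₅⟩
  · exact h.commute_z_pow_sub_z k p hp2
end

section
/- Let Z be the (central) k-subalgebra of D~ generated by x21^p, x2^{2p}, u21^p, u2^{2p}, g^p, g'^p, ζ^p - ζ. Then D~ is a free Z-module of finite rank 16p^6; more precisely, the monomials x1^{n1} * x21^{n21} * x2^{n2} * g^{n} * ζ^{j} * u1^{m1} * u21^{m21} * u2^{m2} with n1, m1 ∈ {0,1}, n2, m2 ∈ {0,...,2p-1}, and n21, m21, j, n ∈ {0,...,p-1} form a basis of D~ as a Z-module. -/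
namespace SuperJordanDouble

variable (k : Type) [Field k]

/-- The central subalgebra `Z` of `D~`. -/
noncomputable def Zc (p : ℕ) : Subalgebra k (tD k) :=
  Algebra.adjoin k
    ({x21 k ^ p, x2 k ^ (2 * p), u21 k ^ p, u2 k ^ (2 * p),
      g k ^ p, gi k ^ p, z k ^ p - z k} : Set (tD k))

/-- The PBW monomials indexing a basis of `D~` over `Z`. -/
noncomputable def monoZ (p : ℕ) :
    Fin 2 × Fin p × Fin (2 * p) × Fin p × Fin p × Fin 2 × Fin p × Fin (2 * p) → tD k
  | (n1, n21, n2, n, j, m1, m21, m2) =>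
      x1 k ^ (n1 : ℕ) * x21 k ^ (n21 : ℕ) * x2 k ^ (n2 : ℕ) * g k ^ (n : ℕ) *
        z k ^ (j : ℕ) * u1 k ^ (m1 : ℕ) * u21 k ^ (m21 : ℕ) * u2 k ^ (m2 : ℕ)

end SuperJordanDouble

open SuperJordanDouble

/-- The defining relations of `D~`, for a tuple of elements of an arbitrary ring. -/
structure DoubleRel {D : Type*} [Ring D] (x1 x2 u1 u2 g gi z : D) : Prop where
  x1sq : x1 * x1 = 0
  x2x21 : x2 * (x1 * x2 + x2 * x1) = (x1 * x2 + x2 * x1) * x2 + x1 * (x1 * x2 + x2 * x1)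
  u1sq : u1 * u1 = 0
  u2u21 : u2 * (u1 * u2 + u2 * u1) = (u1 * u2 + u2 * u1) * u2 + u1 * (u1 * u2 + u2 * u1)
  ggi : g * gi = 1
  gig : gi * g = 1
  zg : z * g = g * z
  gx1 : g * x1 = x1 * g
  gx2 : g * x2 = x2 * g - x1 * g
  u1g : u1 * g = g * u1
  u2g : u2 * g = g * u2 - g * u1
  zx1 : z * x1 = x1 * z + x1
  zx2 : z * x2 = x2 * z + x2
  u1z : u1 * z = z * u1 + u1
  u2z : u2 * z = z * u2 + u2
  u1x1 : u1 * x1 = -(x1 * u1)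
  u1x2 : u1 * x2 = -(x2 * u1) + 1 - g
  u2x1 : u2 * x1 = -(x1 * u2) + 1 - g + x1 * u1
  u2x2 : u2 * x2 = -(x2 * u2) + g * z + x2 * u1

section Rewriting

variable {D : Type*} [Ring D]

theorem mul_mul_of_mul_eq {a b c : D} (h : a * b = c) (d : D) : a * (b * d) = c * d := by
  rw [← mul_assoc, h]

theorem jordan_rewrite {a b : D} (h0 : a * a = 0)
    (h : b * (a * b + b * a) = (a * b + b * a) * b + a * (a * b + b * a)) :
    b * (b * a) = a * (b * b) + a * (b * a) := by
  have h1 : a * (a * b) = 0 := by rw [← mul_assoc, h0, zero_mul]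
  simp only [mul_add, add_mul, mul_assoc, h1, zero_add] at h
  have : b * (a * b) + b * (b * a) = b * (a * b) + (a * (b * b) + a * (b * a)) := by
    rw [h]; abel
  exact add_left_cancel this

/-- The super Jordan relations express the commutation of `b` and `b ^ 2` with `a * b + b * a`. -/
theorem jordan_comm {a b : D} (h0 : a * a = 0)
    (h : b * (a * b + b * a) = (a * b + b * a) * b + a * (a * b + b * a)) :
    Commute (a * b + b * a) a ∧
    b * b * a = a * (b * b) + a * (a * b + b * a) ∧
    b * b * (a * b + b * a) =
      (a * b + b * a) * (b * b) + (a * b + b * a) * (a * b + b * a) := by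
  have h1 : ∀ c, a * (a * c) = 0 := fun c => by rw [← mul_assoc, h0, zero_mul]
  have h2 := jordan_rewrite h0 h
  have h3 : ∀ c, b * (b * (a * c)) = a * (b * (b * c)) + a * (b * (a * c)) := fun c => by
    have := congrArg (· * c) h2
    simpa only [mul_assoc, add_mul] using this
  refine ⟨?_, ?_, ?_⟩
  · simp only [Commute, SemiconjBy, mul_add, add_mul, mul_assoc, h0, h1, mul_zero]
    abel
  · simp only [mul_add, mul_assoc, h2, h1, zero_add]
  · simp only [mul_add, add_mul, mul_assoc, h2, h3, h1, mul_zero]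
    abel

namespace DoubleRel

variable {x1 x2 u1 u2 g gi z : D}

/-- The defining relations oriented as rewriting rules towards the order `x, g, z, u`. -/
theorem rules (h : DoubleRel x1 x2 u1 u2 g gi z) :
    (x1 * x1 = 0 ∧ u1 * u1 = 0 ∧ z * g = g * z ∧ g * x1 = x1 * g ∧ g * x2 = x2 * g - x1 * g ∧
      u1 * g = g * u1 ∧ u2 * g = g * u2 - g * u1 ∧ z * x1 = x1 * z + x1 ∧
      z * x2 = x2 * z + x2 ∧ u1 * z = z * u1 + u1 ∧ u2 * z = z * u2 + u2 ∧
      u1 * x1 = -(x1 * u1) ∧ u1 * x2 = -(x2 * u1) + 1 - g ∧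
      u2 * x1 = -(x1 * u2) + 1 - g + x1 * u1 ∧ u2 * x2 = -(x2 * u2) + g * z + x2 * u1) ∧
    ((∀ d, x1 * (x1 * d) = 0 * d) ∧ (∀ d, u1 * (u1 * d) = 0 * d) ∧
      (∀ d, z * (g * d) = (g * z) * d) ∧ (∀ d, g * (x1 * d) = (x1 * g) * d) ∧
      (∀ d, g * (x2 * d) = (x2 * g - x1 * g) * d) ∧ (∀ d, u1 * (g * d) = (g * u1) * d) ∧
      (∀ d, u2 * (g * d) = (g * u2 - g * u1) * d) ∧ (∀ d, z * (x1 * d) = (x1 * z + x1) * d) ∧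
      (∀ d, z * (x2 * d) = (x2 * z + x2) * d) ∧ (∀ d, u1 * (z * d) = (z * u1 + u1) * d) ∧
      (∀ d, u2 * (z * d) = (z * u2 + u2) * d) ∧ (∀ d, u1 * (x1 * d) = -(x1 * u1) * d) ∧
      (∀ d, u1 * (x2 * d) = (-(x2 * u1) + 1 - g) * d) ∧
      (∀ d, u2 * (x1 * d) = (-(x1 * u2) + 1 - g + x1 * u1) * d) ∧
      (∀ d, u2 * (x2 * d) = (-(x2 * u2) + g * z + x2 * u1) * d)) ∧
    (x2 * (x2 * x1) = x1 * (x2 * x2) + x1 * (x2 * x1) ∧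
      u2 * (u2 * u1) = u1 * (u2 * u2) + u1 * (u2 * u1)) ∧
    ((∀ d, x2 * (x2 * (x1 * d)) = (x1 * (x2 * x2) + x1 * (x2 * x1)) * d) ∧
      (∀ d, u2 * (u2 * (u1 * d)) = (u1 * (u2 * u2) + u1 * (u2 * u1)) * d)) := by
  refine ⟨⟨h.x1sq, h.u1sq, h.zg, h.gx1, h.gx2, h.u1g, h.u2g, h.zx1, h.zx2, h.u1z, h.u2z, h.u1x1,
      h.u1x2, h.u2x1, h.u2x2⟩,
    ⟨mul_mul_of_mul_eq h.x1sq, mul_mul_of_mul_eq h.u1sq, mul_mul_of_mul_eq h.zg,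
      mul_mul_of_mul_eq h.gx1, mul_mul_of_mul_eq h.gx2, mul_mul_of_mul_eq h.u1g,
      mul_mul_of_mul_eq h.u2g, mul_mul_of_mul_eq h.zx1, mul_mul_of_mul_eq h.zx2,
      mul_mul_of_mul_eq h.u1z, mul_mul_of_mul_eq h.u2z, mul_mul_of_mul_eq h.u1x1,
      mul_mul_of_mul_eq h.u1x2, mul_mul_of_mul_eq h.u2x1, mul_mul_of_mul_eq h.u2x2⟩,
    ⟨jordan_rewrite h.x1sq h.x2x21, jordan_rewrite h.u1sq h.u2u21⟩, fun d => ?_, fun d => ?_⟩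
  · rw [← jordan_rewrite h.x1sq h.x2x21]; simp only [mul_assoc]
  · rw [← jordan_rewrite h.u1sq h.u2u21]; simp only [mul_assoc]

theorem x21_rules (h : DoubleRel x1 x2 u1 u2 g gi z) :
    g * (x1 * x2 + x2 * x1) = (x1 * x2 + x2 * x1) * g ∧
    z * (x1 * x2 + x2 * x1) = (x1 * x2 + x2 * x1) * (z + 2) ∧
    u1 * (x1 * x2 + x2 * x1) = (x1 * x2 + x2 * x1) * u1 ∧
    u2 * (x1 * x2 + x2 * x1) = (x1 * x2 + x2 * x1) * (u2 - 2 * u1) + x1 * (1 + g) := by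
  have R := h.rules
  refine ⟨?_, ?_, ?_, ?_⟩ <;>
  · simp only [mul_add, add_mul, mul_sub, sub_mul, mul_assoc, neg_mul, mul_neg, R,
      zero_mul, mul_one, one_mul, two_mul, mul_two]
    abel

theorem u21_rules (h : DoubleRel x1 x2 u1 u2 g gi z) :
    (u1 * u2 + u2 * u1) * g = g * (u1 * u2 + u2 * u1) ∧
    (u1 * u2 + u2 * u1) * z = (z + 2) * (u1 * u2 + u2 * u1) ∧
    (u1 * u2 + u2 * u1) * x1 = x1 * (u1 * u2 + u2 * u1) ∧
    (u1 * u2 + u2 * u1) * x2 = x2 * (u1 * u2 + u2 * u1) + (1 + g) * u1 := by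
  have R := h.rules
  refine ⟨?_, ?_, ?_, ?_⟩ <;>
  · simp only [mul_add, add_mul, mul_sub, sub_mul, mul_assoc, neg_mul, mul_neg, R,
      mul_zero, mul_one, one_mul, two_mul]
    abel

/-- Commutation of `x2 ^ 2` with the remaining generators. -/
theorem x2sq_rules (h : DoubleRel x1 x2 u1 u2 g gi z) :
    x2 * x2 * g - g * (x2 * x2) = (x1 * x2 + x2 * x1) * g ∧
    x2 * x2 * z - z * (x2 * x2) = -(2 * (x2 * x2)) ∧
    x2 * x2 * u1 - u1 * (x2 * x2) = -(x1 * g) ∧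
    x2 * x2 * u2 - u2 * (x2 * x2) = 2 * (x2 * x2 * u1) - x2 + x1 * (g * (z + 1)) := by
  have R := h.rules
  refine ⟨?_, ?_, ?_, ?_⟩ <;>
  · simp only [mul_add, add_mul, mul_sub, sub_mul, mul_assoc, neg_mul, mul_neg, R,
      zero_mul, mul_one, one_mul, two_mul]
    abel

/-- Commutation of `u2 ^ 2` with the remaining generators. -/
theorem u2sq_rules (h : DoubleRel x1 x2 u1 u2 g gi z) :
    u2 * u2 * g - g * (u2 * u2) = -(g * (u1 * u2 + u2 * u1)) ∧
    u2 * u2 * z - z * (u2 * u2) = 2 * (u2 * u2) ∧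
    u2 * u2 * x1 - x1 * (u2 * u2) = u1 - x1 * (u1 * u2 + u2 * u1) ∧
    u2 * u2 * x2 - x2 * (u2 * u2) = u2 * g - x2 * (u1 * u2 + u2 * u1) := by
  have R := h.rules
  refine ⟨?_, ?_, ?_, ?_⟩ <;>
  · simp only [mul_add, add_mul, mul_sub, sub_mul, mul_assoc, neg_mul, mul_neg, R,
      mul_zero, mul_one, one_mul, two_mul]
    abel

end DoubleRel

end Rewriting

section FrobeniusCommute

variable {D : Type*} [Ring D] {p : ℕ}

/-- If `a` acts on the sequence `c` by `[a, c n] = (n + 1) c (n + 1)` in characteristic `p`, then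
`a ^ p` commutes with `c 0`, because `(ad a) ^ p = ad (a ^ p)`. -/
theorem commute_pow_of_ad_chain (hp : p.Prime) (hp2 : 2 < p) (hD : (p : D) = 0) {a : D}
    (c : ℕ → D) (hc : ∀ n : ℕ, a * c n - c n * a = ((n + 1 : ℕ) : D) * c (n + 1)) :
    Commute (a ^ p) (c 0) := by
  set L : Module.End ℤ D := LinearMap.mulLeft ℤ a
  set R : Module.End ℤ D := LinearMap.mulRight ℤ a
  have hL : ∀ (n : ℕ) d, (L ^ n) d = a ^ n * d := by
    intro n
    induction n with
    | zero => simp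
    | succ n ih => intro d; rw [pow_succ, Module.End.mul_apply, ih]; simp [L, pow_succ, mul_assoc]
  have hR : ∀ (n : ℕ) d, (R ^ n) d = d * a ^ n := by
    intro n
    induction n with
    | zero => simp
    | succ n ih => intro d; rw [pow_succ, Module.End.mul_apply, ih]; simp [R, pow_succ', mul_assoc]
  have hcomm : Commute L (-R) := by
    refine Commute.neg_right ?_
    ext d
    simp [L, R, mul_assoc]
  have hiter : ∀ m : ℕ, ((L + -R) ^ m) (c 0) = (m.factorial : D) * c m := by
    intro m
    induction m with
    | zero => simp
    | succ m ih =>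
      rw [pow_succ', Module.End.mul_apply, ih]
      have : (L + -R) ((m.factorial : D) * c m) = a * ((m.factorial : D) * c m) -
          (m.factorial : D) * c m * a := by
        simp [L, R, sub_eq_add_neg]
      rw [this, ← mul_assoc, ← (Nat.cast_commute _ a).eq, mul_assoc, mul_assoc, ← mul_sub, hc,
        ← mul_assoc, ← Nat.cast_mul, Nat.factorial_succ, mul_comm]
  obtain ⟨r, hr⟩ := hcomm.exists_add_pow_prime_eq hp
  have hodd : Odd p := hp.odd_of_ne_two hp2.ne'
  have h1 := hiter p
  rw [hr, hodd.neg_pow] at h1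
  have h2 : (p.factorial : D) = 0 := by
    rw [← Nat.mul_factorial_pred hp.ne_zero, Nat.cast_mul, hD, zero_mul]
  have h3 : ∀ d : D, (p : Module.End ℤ D) d = 0 := fun d => by
    rw [Module.End.natCast_apply, nsmul_eq_mul, hD, zero_mul]
  rw [h2, zero_mul] at h1
  have h4 : ((p : Module.End ℤ D) * L * -R * r) (c 0) = 0 := by
    rw [mul_assoc, mul_assoc, Module.End.mul_apply, h3]
  have h5 : (L ^ p + -R ^ p) (c 0) = a ^ p * c 0 - c 0 * a ^ p := by
    rw [sub_eq_add_neg, ← hL, ← hR]; rfl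
  have h6 : (L ^ p + -R ^ p + (p : Module.End ℤ D) * L * -R * r) (c 0) =
      (L ^ p + -R ^ p) (c 0) + ((p : Module.End ℤ D) * L * -R * r) (c 0) := rfl
  rw [h6, h4, add_zero, h5] at h1
  exact sub_eq_zero.mp h1

theorem commute_pow_of_ad_ad_eq (hp : p.Prime) (hp2 : 2 < p) (hD : (p : D) = 0) {a b c d : D}
    (h1 : a * b - b * a = c) (h2 : a * c - c * a = 2 * d) (h3 : Commute a d) :
    Commute (a ^ p) b := by
  refine commute_pow_of_ad_chain hp hp2 hD
    (fun n => match n with | 0 => b | 1 => c | 2 => d | _ + 3 => 0) fun n => ?_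
  match n with
  | 0 => simp [h1]
  | 1 => simp [h2]
  | 2 => simp [h3.eq]
  | n + 3 => simp

theorem commute_pow_of_commute_ad (hp : p.Prime) (hp2 : 2 < p) (hD : (p : D) = 0) {a b c : D}
    (h1 : a * b - b * a = c) (h2 : Commute a c) : Commute (a ^ p) b :=
  commute_pow_of_ad_ad_eq hp hp2 hD h1 (d := 0) (by rw [h2.eq]; simp) (Commute.zero_right _)

theorem commute_pow_sub_of_mul_eq (hp : p.Prime) (hD : (p : D) = 0) {a b : D}
    (h : SemiconjBy b (a + 1) a) : Commute (a ^ p - a) b := by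
  obtain ⟨r, hr⟩ := (Commute.one_right a).exists_add_pow_prime_eq hp
  have h1 := h.pow_right p
  rw [hr, hD] at h1
  have h2 := h1.sub_right h
  simp only [one_pow, zero_mul, add_zero, add_sub_add_right_eq_sub] at h2
  exact h2.symm

end FrobeniusCommute

section DerivedCommutation

variable {D : Type*} [Ring D]

theorem mul_pow_of_ad_eq_sq {a b : D} (h : a * b = b * a + b * b) (n : ℕ) :
    a * b ^ n = b ^ n * a + n • b ^ (n + 1) := by
  induction n with
  | zero => simp
  | succ n ih =>
    rw [pow_succ, ← mul_assoc, ih, add_mul, mul_assoc, h, mul_add, smul_mul_assoc, ← mul_assoc,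
      ← mul_assoc, ← pow_succ, ← pow_succ]
    module

namespace DoubleRel

variable {x1 x2 u1 u2 g gi z : D} {p : ℕ}

theorem x21_pow_commute (h : DoubleRel x1 x2 u1 u2 g gi z) (hp : p.Prime) (hp2 : 2 < p)
    (hD : (p : D) = 0) {b : D} (hb : b ∈ ({x1, x2, u1, u2, g, z} : Set D)) :
    Commute ((x1 * x2 + x2 * x1) ^ p) b := by
  obtain ⟨hx1, -, -⟩ := jordan_comm h.x1sq h.x2x21
  obtain ⟨hg, hz, hu1, hu2⟩ := h.x21_rules
  have hx2 := h.x2x21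
  set t := x1 * x2 + x2 * x1
  have key : ∀ {b c : D}, t * b - b * t = c → Commute t c → Commute (t ^ p) b :=
    commute_pow_of_commute_ad hp hp2 hD
  have hu1' : Commute t u1 := hu1.symm
  have hg' : Commute t g := hg.symm
  simp only [Set.mem_insert_iff, Set.mem_singleton_iff] at hb
  rcases hb with rfl | rfl | rfl | rfl | rfl | rfl
  · exact hx1.pow_left p
  · refine key (c := -(x1 * t)) (by rw [hx2]; abel) ?_
    exact (hx1.mul_right (Commute.refl t)).neg_right
  · exact hu1'.pow_left p
  · refine key (c := 2 * (t * u1) - x1 * (1 + g)) ?_ ?_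
    · rw [hu2, mul_sub, two_mul u1, two_mul, mul_add]; abel
    · exact ((Commute.ofNat_right t 2).mul_right ((Commute.refl t).mul_right hu1')).sub_right
        (hx1.mul_right ((Commute.one_right t).add_right hg'))
  · exact hg'.pow_left p
  · refine key (c := -(2 * t)) ?_ ((Commute.ofNat_right t 2).mul_right (Commute.refl t)).neg_right
    rw [hz, mul_add, mul_two, two_mul]; abel

theorem u21_pow_commute (h : DoubleRel x1 x2 u1 u2 g gi z) (hp : p.Prime) (hp2 : 2 < p)
    (hD : (p : D) = 0) {b : D} (hb : b ∈ ({x1, x2, u1, u2, g, z} : Set D)) :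
    Commute ((u1 * u2 + u2 * u1) ^ p) b := by
  obtain ⟨hu1, -, -⟩ := jordan_comm h.u1sq h.u2u21
  obtain ⟨hg, hz, hx1, hx2⟩ := h.u21_rules
  have hu2 := h.u2u21
  set s := u1 * u2 + u2 * u1
  have key : ∀ {b c : D}, s * b - b * s = c → Commute s c → Commute (s ^ p) b :=
    commute_pow_of_commute_ad hp hp2 hD
  have hx1' : Commute s x1 := hx1
  have hg' : Commute s g := hg
  simp only [Set.mem_insert_iff, Set.mem_singleton_iff] at hb
  rcases hb with rfl | rfl | rfl | rfl | rfl | rfl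
  · exact hx1'.pow_left p
  · refine key (c := (1 + g) * u1) (by rw [hx2]; abel) ?_
    exact ((Commute.one_right s).add_right hg').mul_right hu1
  · exact hu1.pow_left p
  · refine key (c := -(u1 * s)) (by rw [hu2]; abel) ?_
    exact (hu1.mul_right (Commute.refl s)).neg_right
  · exact hg'.pow_left p
  · refine key (c := 2 * s) ?_ ((Commute.ofNat_right s 2).mul_right (Commute.refl s))
    rw [hz, add_mul]; abel

theorem g_pow_commute (h : DoubleRel x1 x2 u1 u2 g gi z) (hp : p.Prime) (hp2 : 2 < p)
    (hD : (p : D) = 0) {b : D} (hb : b ∈ ({x1, x2, u1, u2, g, z} : Set D)) :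
    Commute (g ^ p) b := by
  have key : ∀ {b c : D}, g * b - b * g = c → Commute g c → Commute (g ^ p) b :=
    commute_pow_of_commute_ad hp hp2 hD
  have hx1 : Commute g x1 := h.gx1
  have hu1 : Commute g u1 := h.u1g.symm
  have hz : Commute g z := h.zg.symm
  simp only [Set.mem_insert_iff, Set.mem_singleton_iff] at hb
  rcases hb with rfl | rfl | rfl | rfl | rfl | rfl
  · exact hx1.pow_left p
  · refine key (c := -(x1 * g)) (by rw [h.gx2]; abel) ?_
    exact (hx1.mul_right (Commute.refl g)).neg_right
  · exact hu1.pow_left p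
  · refine key (c := g * u1) (by rw [h.u2g]; abel) ?_
    exact (Commute.refl g).mul_right hu1
  · exact (Commute.refl b).pow_left p
  · exact hz.pow_left p

theorem z_pow_sub_commute (h : DoubleRel x1 x2 u1 u2 g gi z) (hp : p.Prime) (hp2 : 2 < p)
    (hD : (p : D) = 0) {b : D} (hb : b ∈ ({x1, x2, u1, u2, g, z} : Set D)) :
    Commute (z ^ p - z) b := by
  have hodd : Odd p := hp.odd_of_ne_two hp2.ne'
  have key : ∀ {b : D}, z * b = b * z + b → Commute (z ^ p - z) b := fun hb =>
    commute_pow_sub_of_mul_eq hp hD (by rw [SemiconjBy, hb, mul_add, mul_one])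
  have key' : ∀ {b : D}, b * z = z * b + b → Commute (z ^ p - z) b := fun {b} hb => by
    have := commute_pow_sub_of_mul_eq hp hD (a := -z) (b := b) (by
      rw [SemiconjBy, mul_add, mul_neg, hb]; noncomm_ring)
    rw [hodd.neg_pow] at this
    rw [show z ^ p - z = -(-z ^ p - -z) by abel]
    exact this.neg_left
  simp only [Set.mem_insert_iff, Set.mem_singleton_iff] at hb
  rcases hb with rfl | rfl | rfl | rfl | rfl | rfl
  · exact key h.zx1
  · exact key h.zx2
  · exact key' h.u1z
  · exact key' h.u2z
  · have : Commute z b := h.zg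
    exact (this.pow_left p).sub_left this
  · exact ((Commute.refl b).pow_left p).sub_left (Commute.refl b)

theorem x2sq_pow_commute (h : DoubleRel x1 x2 u1 u2 g gi z) (hp : p.Prime) (hp2 : 2 < p)
    (hD : (p : D) = 0) {b : D} (hb : b ∈ ({x1, x2, u1, u2, g, z} : Set D)) :
    Commute (x2 ^ (2 * p)) b := by
  obtain ⟨ht, hx1, hyt⟩ := jordan_comm h.x1sq h.x2x21
  obtain ⟨htg, htz, -, -⟩ := h.x21_rules
  obtain ⟨hg, hz, hu1, hu2⟩ := h.x2sq_rules
  have hgx1 := h.gx1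
  have hx2 : Commute (x2 * x2) x2 := (Commute.refl x2).mul_left (Commute.refl x2)
  rw [pow_mul, pow_two]
  set t := x1 * x2 + x2 * x1
  set y := x2 * x2
  clear_value t y
  replace hg : y * g = g * y + t * g := by rw [← hg]; abel
  replace hz : y * z = z * y - 2 • y := by
    rw [sub_eq_iff_eq_add.mp hz, two_mul, two_nsmul]; abel
  replace hu1 : y * u1 = u1 * y - x1 * g := by rw [sub_eq_iff_eq_add.mp hu1]; abel
  replace hu2 : y * u2 = u2 * y + (2 • (u1 * y - x1 * g) - x2 + x1 * g * (z + 1)) := by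
    rw [sub_eq_iff_eq_add.mp hu2, two_mul, two_nsmul, ← mul_assoc, hu1]
    abel
  have htn : ∀ n : ℕ, y * t ^ n = t ^ n * y + n • t ^ (n + 1) := mul_pow_of_ad_eq_sq hyt
  have hxt : ∀ n : ℕ, y * (x1 * t ^ n) = x1 * t ^ n * y + (n + 1) • (x1 * t ^ (n + 1)) := by
    intro n
    rw [← mul_assoc, hx1, add_mul, mul_assoc, htn, mul_assoc x1 t, ← pow_succ', mul_add,
      mul_smul_comm, mul_assoc]
    module
  have hxtg : ∀ n : ℕ, y * (x1 * t ^ n * g) =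
      x1 * t ^ n * g * y + (n + 2) • (x1 * t ^ (n + 1) * g) := by
    intro n
    rw [← mul_assoc, hxt, add_mul, mul_assoc _ y, hg, mul_add, ← mul_assoc _ t, mul_assoc x1 _ t,
      ← pow_succ, smul_mul_assoc, ← mul_assoc]
    module
  simp only [Set.mem_insert_iff, Set.mem_singleton_iff] at hb
  rcases hb with rfl | rfl | rfl | rfl | rfl | rfl
  · simpa using commute_pow_of_ad_chain hp hp2 hD (fun n => b * t ^ n) fun n => by
      rw [hxt, ← nsmul_eq_mul]
      module
  · exact hx2.pow_left p
  · refine commute_pow_of_ad_chain hp hp2 hD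
      (fun n => match n with | 0 => b | n + 1 => -(x1 * t ^ n * g)) fun n => ?_
    match n with
    | 0 => simp [hu1]
    | n + 1 =>
      simp only [mul_neg, hxtg, ← nsmul_eq_mul]
      rw [neg_mul]
      module
  · refine commute_pow_of_ad_chain hp hp2 hD
      (fun n => match n with
        | 0 => b
        | 1 => 2 • (u1 * y) - x2 + x1 * g * (z - 1)
        | n + 2 => x1 * t ^ (n + 1) * g * (z - 1) - 2 • (x1 * t ^ n * g * y)) fun n => ?_
    have hmove : ∀ n : ℕ, y * (x1 * t ^ n * g * (z - 1)) - x1 * t ^ n * g * (z - 1) * y =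
        (n + 2) • (x1 * t ^ (n + 1) * g * (z - 1)) - 2 • (x1 * t ^ n * g * y) := by
      intro n
      rw [← mul_assoc, hxtg, add_mul, mul_assoc _ y, mul_sub y, hz]
      simp only [mul_sub, sub_mul, mul_one, mul_smul_comm, smul_mul_assoc, ← mul_assoc]
      module
    have hmove' : ∀ n : ℕ, y * (x1 * t ^ n * g * y) - x1 * t ^ n * g * y * y =
        (n + 2) • (x1 * t ^ (n + 1) * g * y) := by
      intro n
      rw [← mul_assoc, hxtg, add_mul, smul_mul_assoc]
      module
    match n with
    | 0 =>
      simp only [hu2, ← nsmul_eq_mul, mul_sub, mul_add, mul_one]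
      module
    | 1 =>
      have e0 := hmove 0
      simp only [pow_zero, mul_one] at e0
      have e1 : y * (u1 * y) - u1 * y * y = - (x1 * g * y) := by
        rw [← mul_assoc, hu1, sub_mul]; abel
      have e2 : y * x2 - x2 * y = 0 := sub_eq_zero.mpr hx2
      simp only [mul_add, add_mul, mul_sub, sub_mul, mul_smul_comm, smul_mul_assoc,
        ← nsmul_eq_mul, pow_zero, mul_one] at e0 e1 e2 ⊢
      linear_combination (norm := module) e0 + 2 • e1 - e2
    | n + 2 =>
      have e0 := hmove (n + 1)
      have e1 := hmove' n
      simp only [← nsmul_eq_mul]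
      rw [mul_sub y, sub_mul _ _ y, mul_smul_comm, smul_mul_assoc, sub_sub_sub_comm, e0,
        ← smul_sub, e1]
      module
  · simpa using commute_pow_of_ad_chain hp hp2 hD (fun n => t ^ n * b) fun n => by
      rw [← mul_assoc, htn, add_mul, mul_assoc _ y, hg, mul_add, ← mul_assoc, ← mul_assoc,
        ← pow_succ, smul_mul_assoc, ← nsmul_eq_mul]
      module
  · exact commute_pow_of_commute_ad hp hp2 hD (c := -(2 • y)) (by rw [hz]; abel)
      ((Commute.refl y).smul_right 2).neg_right

theorem u2sq_pow_commute (h : DoubleRel x1 x2 u1 u2 g gi z) (hp : p.Prime) (hp2 : 2 < p)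
    (hD : (p : D) = 0) {b : D} (hb : b ∈ ({x1, x2, u1, u2, g, z} : Set D)) :
    Commute (u2 ^ (2 * p)) b := by
  obtain ⟨hs, hu1, hqs⟩ := jordan_comm h.u1sq h.u2u21
  obtain ⟨hsg, hsz, -, -⟩ := h.u21_rules
  obtain ⟨hg, hz, hx1, hx2⟩ := h.u2sq_rules
  have hu2 : Commute (u2 * u2) u2 := (Commute.refl u2).mul_left (Commute.refl u2)
  rw [pow_mul, pow_two]
  set s := u1 * u2 + u2 * u1
  set q := u2 * u2
  clear_value s q
  have hsn : ∀ n : ℕ, q * s ^ n = s ^ n * q + n • s ^ (n + 1) := mul_pow_of_ad_eq_sq hqs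
  have hgs : Commute q (g * s) := by
    rw [Commute, SemiconjBy, ← mul_assoc, sub_eq_iff_eq_add.mp hg, add_mul, mul_assoc, hqs, neg_mul,
      mul_add]
    noncomm_ring
  have hx1s : q * (x1 * s) = x1 * s * q + u1 * s := by
    rw [← mul_assoc, sub_eq_iff_eq_add.mp hx1, add_mul, sub_mul, mul_assoc x1 q, hqs]
    noncomm_ring
  have hx2s : q * (x2 * s) = x2 * s * q + u2 * (g * s) := by
    rw [← mul_assoc, sub_eq_iff_eq_add.mp hx2, add_mul, sub_mul, mul_assoc x2 q, hqs]
    noncomm_ring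
  simp only [Set.mem_insert_iff, Set.mem_singleton_iff] at hb
  rcases hb with rfl | rfl | rfl | rfl | rfl | rfl
  · refine commute_pow_of_commute_ad hp hp2 hD hx1 ?_
    rw [Commute, SemiconjBy, mul_sub, hu1, hx1s, sub_mul]
    abel
  · refine commute_pow_of_ad_ad_eq hp hp2 hD (d := -(u2 * (g * s))) hx2 ?_
      (hu2.mul_right hgs).neg_right
    rw [mul_sub, hx2s, ← mul_assoc, hu2.eq, mul_assoc u2, sub_eq_iff_eq_add.mp hg]
    noncomm_ring
  · simpa using commute_pow_of_ad_chain hp hp2 hD (fun n => b * s ^ n) fun n => by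
      rw [← mul_assoc, hu1, add_mul, mul_assoc b q, hsn, mul_assoc b s, ← pow_succ', mul_add,
        mul_smul_comm, ← nsmul_eq_mul, ← mul_assoc]
      module
  · exact hu2.pow_left p
  · exact commute_pow_of_commute_ad hp hp2 hD hg hgs.neg_right
  · exact commute_pow_of_commute_ad hp hp2 hD hz
      ((Commute.ofNat_right q 2).mul_right (Commute.refl q))

/-- The seven central elements. -/
theorem commute_central (h : DoubleRel x1 x2 u1 u2 g gi z) (hp : p.Prime) (hp2 : 2 < p)
    (hD : (p : D) = 0) {a b : D}
    (ha : a ∈ ({(x1 * x2 + x2 * x1) ^ p, x2 ^ (2 * p), (u1 * u2 + u2 * u1) ^ p, u2 ^ (2 * p),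
      g ^ p, gi ^ p, z ^ p - z} : Set D))
    (hb : b ∈ ({x1, x2, u1, u2, g, gi, z} : Set D)) : Commute a b := by
  have hb' : b ∈ ({x1, x2, u1, u2, g, z} : Set D) ∨ b = gi := by
    simp only [Set.mem_insert_iff, Set.mem_singleton_iff] at hb ⊢
    tauto
  have hunit : ∀ {a : D}, (∀ b ∈ ({x1, x2, u1, u2, g, z} : Set D), Commute a b) →
      ∀ {b : D}, b ∈ ({x1, x2, u1, u2, g, z} : Set D) ∨ b = gi → Commute a b := by
    rintro a hab b (hb | rfl)
    · exact hab b hb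
    · exact Commute.units_inv_right (u := ⟨g, b, h.ggi, h.gig⟩) (hab g (by simp))
  have hgp : ∀ {b : D}, b ∈ ({x1, x2, u1, u2, g, z} : Set D) ∨ b = gi → Commute (g ^ p) b :=
    hunit fun b hb => h.g_pow_commute hp hp2 hD hb
  simp only [Set.mem_insert_iff, Set.mem_singleton_iff] at ha
  rcases ha with rfl | rfl | rfl | rfl | rfl | rfl | rfl
  · exact hunit (fun b hb => h.x21_pow_commute hp hp2 hD hb) hb'
  · exact hunit (fun b hb => h.x2sq_pow_commute hp hp2 hD hb) hb'
  · exact hunit (fun b hb => h.u21_pow_commute hp hp2 hD hb) hb'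
  · exact hunit (fun b hb => h.u2sq_pow_commute hp hp2 hD hb) hb'
  · exact hgp hb'
  · exact Commute.units_inv_left (u := ⟨g, gi, h.ggi, h.gig⟩ ^ p) (by simpa using hgp hb')
  · exact hunit (fun b hb => h.z_pow_sub_commute hp hp2 hD hb) hb'

end DoubleRel

end DerivedCommutation

section Spanning

open Algebra Submodule Subalgebra

variable {R A : Type*} [CommRing R] [Ring A] [Algebra R A]

theorem adjoin_toSubmodule_le_of_mul_mem {S : Submodule R A} {s : Set A} (h1 : (1 : A) ∈ S)
    (h : ∀ x ∈ s, ∀ w ∈ S, x * w ∈ S) : toSubmodule (adjoin R s) ≤ S := by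
  have key : ∀ a ∈ adjoin R s, ∀ w ∈ S, a * w ∈ S := by
    intro a ha
    induction ha using adjoin_induction with
    | mem x hx => exact h x hx
    | algebraMap r => intro w hw; rw [← Algebra.smul_def]; exact S.smul_mem r hw
    | add a b _ _ iha ihb => intro w hw; rw [add_mul]; exact S.add_mem (iha w hw) (ihb w hw)
    | mul a b _ _ iha ihb => intro w hw; rw [mul_assoc]; exact iha _ (ihb w hw)
  intro a ha
  simpa using key a ha 1 h1

/-- If the generators of a subalgebra can be moved to the left past `span T` at the price of
coefficients in `C`, then so can the whole subalgebra. -/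
theorem span_mul_adjoin_le {C : Submodule R A} {T s : Set A} (h1 : 1 ≤ C) (hC : C * C ≤ C)
    (h : ∀ x ∈ s, ∀ u ∈ T, u * x ∈ C * span R T) :
    span R T * toSubmodule (adjoin R s) ≤ C * span R T := by
  have key : ∀ a ∈ adjoin R s, span R T * span R {a} ≤ C * span R T := by
    intro a ha
    induction ha using adjoin_induction with
    | mem x hx =>
      rw [span_mul_span, span_le]
      rintro _ ⟨u, hu, y, rfl, rfl⟩
      exact h y hx u hu
    | algebraMap r =>
      have : span R {algebraMap R A r} ≤ 1 := by
        rw [span_singleton_le_iff_mem]; exact algebraMap_mem r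
      calc span R T * span R {algebraMap R A r} ≤ span R T * 1 := by gcongr
        _ = 1 * span R T := by rw [mul_one, one_mul]
        _ ≤ C * span R T := by gcongr
    | add a b _ _ iha ihb =>
      rw [Submodule.mul_le] at iha ihb ⊢
      intro u hu y hy
      obtain ⟨r, rfl⟩ := mem_span_singleton.mp hy
      rw [smul_add, mul_add]
      exact add_mem (iha u hu _ (smul_mem _ r (mem_span_singleton_self a)))
        (ihb u hu _ (smul_mem _ r (mem_span_singleton_self b)))
    | mul a b _ _ iha ihb =>
      calc span R T * span R {a * b} = span R T * span R {a} * span R {b} := by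
            rw [mul_assoc, span_mul_span R {a}, Set.singleton_mul_singleton]
        _ ≤ C * span R T * span R {b} := by gcongr
        _ = C * (span R T * span R {b}) := mul_assoc _ _ _
        _ ≤ C * (C * span R T) := by gcongr
        _ = C * C * span R T := (mul_assoc _ _ _).symm
        _ ≤ C * span R T := by gcongr
  rw [Submodule.mul_le]
  exact fun u hu a ha => key a ha (mul_mem_mul hu (mem_span_singleton_self a))

theorem adjoin_mul_span_le {C : Submodule R A} {T s : Set A} (h1 : 1 ≤ C) (hC : C * C ≤ C)
    (h : ∀ x ∈ s, ∀ u ∈ T, x * u ∈ span R T * C) :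
    toSubmodule (adjoin R s) * span R T ≤ span R T * C := by
  have key : ∀ a ∈ adjoin R s, span R {a} * span R T ≤ span R T * C := by
    intro a ha
    induction ha using adjoin_induction with
    | mem x hx =>
      rw [span_mul_span, span_le]
      rintro _ ⟨y, rfl, u, hu, rfl⟩
      exact h y hx u hu
    | algebraMap r =>
      have : span R {algebraMap R A r} ≤ 1 := by
        rw [span_singleton_le_iff_mem]; exact algebraMap_mem r
      calc span R {algebraMap R A r} * span R T ≤ 1 * span R T := by gcongr
        _ = span R T * 1 := by rw [mul_one, one_mul]
        _ ≤ span R T * C := by gcongr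
    | add a b _ _ iha ihb =>
      rw [Submodule.mul_le] at iha ihb ⊢
      intro y hy u hu
      obtain ⟨r, rfl⟩ := mem_span_singleton.mp hy
      rw [smul_add, add_mul]
      exact add_mem (iha _ (smul_mem _ r (mem_span_singleton_self a)) u hu)
        (ihb _ (smul_mem _ r (mem_span_singleton_self b)) u hu)
    | mul a b _ _ iha ihb =>
      calc span R {a * b} * span R T = span R {a} * (span R {b} * span R T) := by
            rw [← mul_assoc, span_mul_span R {a}, Set.singleton_mul_singleton]
        _ ≤ span R {a} * (span R T * C) := by gcongr
        _ = span R {a} * span R T * C := (mul_assoc _ _ _).symm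
        _ ≤ span R T * C * C := by gcongr
        _ = span R T * (C * C) := mul_assoc _ _ _
        _ ≤ span R T * C := by gcongr
  rw [Submodule.mul_le]
  exact fun a ha u hu => key a ha (mul_mem_mul (mem_span_singleton_self a) hu)

variable (R) in
/-- The span of the powers `a ^ i`, `i < n`. -/
def powSpan (a : A) (n : ℕ) : Submodule R A := span R (Set.range fun i : Fin n => a ^ (i : ℕ))

theorem pow_mem_powSpan {a : A} {n i : ℕ} (hi : i < n) : a ^ i ∈ powSpan R a n :=
  subset_span ⟨⟨i, hi⟩, rfl⟩

theorem one_mem_powSpan {a : A} {n : ℕ} (hn : 0 < n) : (1 : A) ∈ powSpan R a n := by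
  simpa using pow_mem_powSpan (R := R) (a := a) hn

theorem mul_mem_powSpan {a : A} {n : ℕ} (h : a ^ n ∈ powSpan R a n) {w : A}
    (hw : w ∈ powSpan R a n) : a * w ∈ powSpan R a n := by
  induction hw using span_induction with
  | mem w hw =>
    obtain ⟨i, rfl⟩ := hw
    rcases (Nat.succ_le_of_lt i.isLt).lt_or_eq with hi | hi
    · simpa only [← pow_succ'] using pow_mem_powSpan hi
    · simpa only [← pow_succ', ← Nat.succ_eq_add_one, hi] using h
  | zero => rw [mul_zero]; exact zero_mem _
  | add x y _ _ hx hy => rw [mul_add]; exact add_mem hx hy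
  | smul r x _ hx => rw [mul_smul_comm]; exact smul_mem _ r hx

theorem algebraMap_mem_powSpan {a : A} {n : ℕ} (hn : 0 < n) (r : R) :
    algebraMap R A r ∈ powSpan R a n := by
  rw [Algebra.algebraMap_eq_smul_one]
  exact smul_mem _ r (one_mem_powSpan hn)

/-- In a super Jordan plane where `(a b + b a) ^ m` and `b ^ n` are scalars, ordered monomials
span. -/
theorem adjoin_jordan_le {a b : A} {m n : ℕ} (hm : 0 < m) (hn : 0 < n) (h0 : a * a = 0)
    (h : b * (a * b + b * a) = (a * b + b * a) * b + a * (a * b + b * a))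
    (ht : (a * b + b * a) ^ m ∈ powSpan R (a * b + b * a) m) (hb : b ^ n ∈ powSpan R b n) :
    toSubmodule (adjoin R {a, b}) ≤ powSpan R a 2 * powSpan R (a * b + b * a) m * powSpan R b n := by
  have hta := (jordan_comm h0 h).1
  have hba : b * a = (a * b + b * a) - a * b := by abel
  set t := a * b + b * a
  clear_value t
  have hbt : ∀ i : ℕ, b * t ^ i = t ^ i * b + i • (a * t ^ i) := by
    intro i
    induction i with
    | zero => simp
    | succ i ih =>
      rw [pow_succ, ← mul_assoc, ih, add_mul, mul_assoc, h, mul_add, smul_mul_assoc,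
        ← mul_assoc (t ^ i) a t, (hta.pow_left i).eq]
      simp only [mul_assoc]
      module
  set S := powSpan R a 2 * powSpan R t m * powSpan R b n
  have hmon : ∀ w ∈ powSpan R t m, ∀ v ∈ powSpan R b n, w * v ∈ S := by
    intro w hw v hv
    have := mul_mem_mul (mul_mem_mul (one_mem_powSpan (R := R) (a := a) two_pos) hw) hv
    rwa [one_mul] at this
  have hamon : ∀ w ∈ powSpan R t m, ∀ v ∈ powSpan R b n, a * (w * v) ∈ S := by
    intro w hw v hv
    have := mul_mem_mul (mul_mem_mul (pow_mem_powSpan (R := R) (a := a) one_lt_two) hw) hv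
    rwa [pow_one, mul_assoc a w v] at this
  have hind : ∀ {c : A}, (∀ i < m, ∀ v ∈ powSpan R b n, c * (t ^ i * v) ∈ S) →
      (∀ i < m, ∀ v ∈ powSpan R b n, c * (a * (t ^ i * v)) ∈ S) → ∀ w ∈ S, c * w ∈ S := by
    intro c h1 h2 w hw
    have hc : S ≤ S.comap (LinearMap.mulLeft R c) := by
      refine Submodule.mul_le.mpr fun w hw v hv => ?_
      suffices powSpan R a 2 * powSpan R t m ≤
          S.comap (LinearMap.mulLeft R c ∘ₗ LinearMap.mulRight R v) from this hw
      rw [powSpan, powSpan, span_mul_span, span_le]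
      rintro _ ⟨_, ⟨i, rfl⟩, _, ⟨j, rfl⟩, rfl⟩
      fin_cases i
      · simpa using h1 j j.isLt v hv
      · simpa [mul_assoc] using h2 j j.isLt v hv
    exact hc hw
  have ha : ∀ w ∈ S, a * w ∈ S := by
    refine hind (fun i hi v hv => hamon _ (pow_mem_powSpan hi) v hv) fun i hi v hv => ?_
    rw [← mul_assoc, h0, zero_mul]
    exact zero_mem _
  have hb1 : ∀ i < m, ∀ v ∈ powSpan R b n, b * (t ^ i * v) ∈ S := by
    intro i hi v hv
    rw [← mul_assoc, hbt, add_mul, mul_assoc, smul_mul_assoc, mul_assoc]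
    exact add_mem (hmon _ (pow_mem_powSpan hi) _ (mul_mem_powSpan hb hv))
      (nsmul_mem (hamon _ (pow_mem_powSpan hi) v hv) i)
  have hb : ∀ w ∈ S, b * w ∈ S := by
    refine hind hb1 fun i hi v hv => ?_
    rw [← mul_assoc, hba, sub_mul, ← mul_assoc, mul_assoc a b]
    exact sub_mem (hmon _ (mul_mem_powSpan ht (pow_mem_powSpan hi)) v hv) (ha _ (hb1 i hi v hv))
  refine adjoin_toSubmodule_le_of_mul_mem ?_ ?_
  · simpa using hmon 1 (one_mem_powSpan hm) 1 (one_mem_powSpan hn)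
  · rintro x (rfl | rfl)
    exacts [ha, hb]

theorem adjoin_commute_le {a b : A} {m n : ℕ} (hm : 0 < m) (hn : 0 < n) (h : b * a = a * b)
    (ha : a ^ m ∈ powSpan R a m) (hb : b ^ n ∈ powSpan R b n) :
    toSubmodule (adjoin R {a, b}) ≤ powSpan R a m * powSpan R b n := by
  refine adjoin_toSubmodule_le_of_mul_mem ?_ ?_
  · simpa using mul_mem_mul (one_mem_powSpan (R := R) (a := a) hm) (one_mem_powSpan (a := b) hn)
  · rintro x (rfl | rfl) w hw
    · refine (Submodule.mul_le.mpr fun w hw v hv => ?_ : powSpan R x m * powSpan R b n ≤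
        (powSpan R x m * powSpan R b n).comap (LinearMap.mulLeft R x)) hw
      rw [Submodule.mem_comap, LinearMap.mulLeft_apply, ← mul_assoc]
      exact mul_mem_mul (mul_mem_powSpan ha hw) hv
    · refine (Submodule.mul_le.mpr fun w hw v hv => ?_ : powSpan R a m * powSpan R x n ≤
        (powSpan R a m * powSpan R x n).comap (LinearMap.mulLeft R x)) hw
      have hc : x * w = w * x := by
        induction hw using span_induction with
        | mem w hw => obtain ⟨i, rfl⟩ := hw; exact (Commute.pow_right h i).eq
        | zero => simp
        | add y z _ _ hy hz => rw [mul_add, add_mul, hy, hz]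
        | smul r y _ hy => rw [mul_smul_comm, smul_mul_assoc, hy]
      rw [Submodule.mem_comap, LinearMap.mulLeft_apply, ← mul_assoc, hc, mul_assoc]
      exact mul_mem_mul hw (mul_mem_powSpan hb hv)

end Spanning

section DoubleSpanning

open Algebra Submodule Subalgebra

variable {R D : Type*} [CommRing R] [Ring D] [Algebra R D] {x1 x2 u1 u2 g gi z : D}

theorem one_le_toSubmodule (S : Subalgebra R D) : 1 ≤ toSubmodule S := by
  rw [← Algebra.toSubmodule_bot]
  exact bot_le (a := S)

namespace DoubleRel

/-- Triangular decomposition. -/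
theorem adjoin_mul_adjoin_mul_adjoin_eq_top (h : DoubleRel x1 x2 u1 u2 g gi z)
    (hgi : gi ∈ adjoin R {g, z}) (htop : adjoin R {x1, x2, u1, u2, g, gi, z} = ⊤) :
    toSubmodule (adjoin R {x1, x2}) * toSubmodule (adjoin R {g, z}) *
      toSubmodule (adjoin R {u1, u2}) = ⊤ := by
  set X := toSubmodule (adjoin R {x1, x2}) with hX
  set H := toSubmodule (adjoin R {g, z}) with hH
  set U := toSubmodule (adjoin R {u1, u2}) with hU
  have mX1 : x1 ∈ X := subset_adjoin (by simp)
  have mX2 : x2 ∈ X := subset_adjoin (by simp)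
  have mg : g ∈ H := subset_adjoin (by simp)
  have mz : z ∈ H := subset_adjoin (by simp)
  have mU1 : u1 ∈ U := subset_adjoin (by simp)
  have mU2 : u2 ∈ U := subset_adjoin (by simp)
  have oX : 1 ≤ X := one_le_toSubmodule _
  have oH : 1 ≤ H := one_le_toSubmodule _
  have oU : 1 ≤ U := one_le_toSubmodule _
  have eX : X * X = X := Subalgebra.isIdempotentElem_toSubmodule _
  have eH : H * H = H := Subalgebra.isIdempotentElem_toSubmodule _
  have eU : U * U = U := Subalgebra.isIdempotentElem_toSubmodule _
  have o1 : ∀ {S : Submodule R D}, 1 ≤ S → (1 : D) ∈ S := fun h => Submodule.one_le.mp h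
  set V₀ : Set D := {1, x1, x2}
  set W₀ : Set D := {1, u1, u2}
  have hV : span R V₀ ≤ X := span_le.mpr (by
    rintro _ (rfl | rfl | rfl); exacts [o1 oX, mX1, mX2])
  have hW : span R W₀ ≤ U := span_le.mpr (by
    rintro _ (rfl | rfl | rfl); exacts [o1 oU, mU1, mU2])
  have v1 : 1 ∈ span R V₀ := subset_span (by simp [V₀])
  have vx1 : x1 ∈ span R V₀ := subset_span (by simp [V₀])
  have vx2 : x2 ∈ span R V₀ := subset_span (by simp [V₀])
  have w1 : 1 ∈ span R W₀ := subset_span (by simp [W₀])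
  have wu1 : u1 ∈ span R W₀ := subset_span (by simp [W₀])
  have wu2 : u2 ∈ span R W₀ := subset_span (by simp [W₀])
  have HV : H * span R V₀ ≤ span R V₀ * H := by
    refine adjoin_mul_span_le oH eH.le ?_
    have aux : ∀ {c v d : D}, c * v = v * d → v ∈ span R V₀ → d ∈ H →
        c * v ∈ span R V₀ * H := fun e hv hd => e ▸ mul_mem_mul hv hd
    rintro c (rfl | rfl) v (rfl | rfl | rfl)
    · exact aux (by rw [mul_one, one_mul]) v1 mg
    · exact aux h.gx1 vx1 mg
    · rw [h.gx2]
      exact sub_mem (mul_mem_mul vx2 mg) (mul_mem_mul vx1 mg)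
    · exact aux (by rw [mul_one, one_mul]) v1 mz
    · exact aux (d := c + 1) (by rw [h.zx1, mul_add, mul_one]) vx1 (add_mem mz (o1 oH))
    · exact aux (d := c + 1) (by rw [h.zx2, mul_add, mul_one]) vx2 (add_mem mz (o1 oH))
  have HX : H * X ≤ X * H := by
    have e : span R (adjoin R {g, z} : Set D) = H := span_eq H
    have := span_mul_adjoin_le (R := R) (C := X) (T := (adjoin R {g, z} : Set D)) (s := {x1, x2})
      oX eX.le (by
        intro x hx u hu
        rw [e]
        have : u * x ∈ H * span R V₀ := mul_mem_mul hu (subset_span (by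
          rcases hx with rfl | rfl <;> simp [V₀]))
        exact Submodule.mul_le.mpr (fun a ha b hb => mul_mem_mul (hV ha) hb) (HV this))
    rwa [e] at this
  have WX : span R W₀ * X ≤ X * H * span R W₀ := by
    have o : (1 : Submodule R D) ≤ X * H := by simpa using mul_le_mul' oX oH
    have xm : ∀ {a}, a ∈ X → a ∈ X * H := fun ha => by simpa using mul_mem_mul ha (o1 oH)
    have hm : ∀ {a}, a ∈ H → a ∈ X * H := fun ha => by simpa using mul_mem_mul (o1 oX) ha
    have sm : ∀ {a}, a ∈ X * H → a ∈ X * H * span R W₀ := fun ha => by simpa using mul_mem_mul ha w1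
    refine span_mul_adjoin_le o ?_ ?_
    · calc X * H * (X * H) = X * (H * X) * H := by simp only [mul_assoc]
        _ ≤ X * (X * H) * H := by gcongr
        _ = X * X * (H * H) := by simp only [mul_assoc]
        _ = X * H := by rw [eX, eH]
    · rintro x (rfl | rfl) u (rfl | rfl | rfl)
      · simpa using sm (xm mX1)
      · rw [h.u1x1]
        exact neg_mem (mul_mem_mul (xm mX1) wu1)
      · rw [h.u2x1]
        exact add_mem (sub_mem (add_mem (neg_mem (mul_mem_mul (xm mX1) wu2)) (sm (o1 o)))
          (sm (hm mg))) (mul_mem_mul (xm mX1) wu1)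
      · simpa using sm (xm mX2)
      · rw [h.u1x2]
        exact sub_mem (add_mem (neg_mem (mul_mem_mul (xm mX2) wu1)) (sm (o1 o))) (sm (hm mg))
      · rw [h.u2x2]
        exact add_mem (add_mem (neg_mem (mul_mem_mul (xm mX2) wu2))
          (sm (hm (eH.le (mul_mem_mul mg mz))))) (mul_mem_mul (xm mX2) wu1)
  have WH : span R W₀ * H ≤ H * span R W₀ := by
    have aux : ∀ {c v d : D}, v * c = d * v → v ∈ span R W₀ → d ∈ H →
        v * c ∈ H * span R W₀ := fun e hv hd => e ▸ mul_mem_mul hd hv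
    refine span_mul_adjoin_le oH eH.le ?_
    rintro c (rfl | rfl) v (rfl | rfl | rfl)
    · exact aux (by rw [mul_one, one_mul]) w1 mg
    · exact aux h.u1g wu1 mg
    · rw [h.u2g]
      exact sub_mem (mul_mem_mul mg wu2) (mul_mem_mul mg wu1)
    · exact aux (by rw [mul_one, one_mul]) w1 mz
    · exact aux (d := c + 1) (by rw [h.u1z, add_mul, one_mul]) wu1 (add_mem mz (o1 oH))
    · exact aux (d := c + 1) (by rw [h.u2z, add_mul, one_mul]) wu2 (add_mem mz (o1 oH))
  have XW : X * (X * H * U) ≤ X * H * U := by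
    rw [← mul_assoc, ← mul_assoc, eX]
  have HW : H * (X * H * U) ≤ X * H * U := by
    calc H * (X * H * U) = H * X * H * U := by simp only [mul_assoc]
      _ ≤ X * H * H * U := by gcongr
      _ = X * H * U := by rw [mul_assoc X H H, eH]
  have UW : span R W₀ * (X * H * U) ≤ X * H * U := by
    calc span R W₀ * (X * H * U) = span R W₀ * X * H * U := by simp only [mul_assoc]
      _ ≤ X * H * span R W₀ * H * U := by gcongr
      _ = X * H * (span R W₀ * H) * U := by simp only [mul_assoc]
      _ ≤ X * H * (H * span R W₀) * U := by gcongr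
      _ = X * (H * H) * (span R W₀ * U) := by simp only [mul_assoc]
      _ ≤ X * (H * H) * (U * U) := by gcongr
      _ = X * H * U := by rw [eH, eU]
  rw [_root_.eq_top_iff, ← Algebra.top_toSubmodule, ← htop]
  refine adjoin_toSubmodule_le_of_mul_mem ?_ ?_
  · simpa using mul_mem_mul (mul_mem_mul (o1 oX) (o1 oH)) (o1 oU)
  · rintro x (rfl | rfl | rfl | rfl | rfl | rfl | rfl) w hw
    exacts [XW (mul_mem_mul mX1 hw), XW (mul_mem_mul mX2 hw), UW (mul_mem_mul wu1 hw),
      UW (mul_mem_mul wu2 hw), HW (mul_mem_mul mg hw), HW (mul_mem_mul hgi hw),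
      HW (mul_mem_mul mz hw)]

/-- If suitable powers of the generators are scalars, the PBW monomials with restricted exponents
span. -/
theorem span_monomials_eq_top (h : DoubleRel x1 x2 u1 u2 g gi z) {p : ℕ} (hp : 0 < p)
    (hx21 : (x1 * x2 + x2 * x1) ^ p ∈ powSpan R (x1 * x2 + x2 * x1) p)
    (hx2 : x2 ^ (2 * p) ∈ powSpan R x2 (2 * p))
    (hu21 : (u1 * u2 + u2 * u1) ^ p ∈ powSpan R (u1 * u2 + u2 * u1) p)
    (hu2 : u2 ^ (2 * p) ∈ powSpan R u2 (2 * p))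
    (hg : g ^ p ∈ powSpan R g p) (hz : z ^ p ∈ powSpan R z p)
    (hgi : gi ∈ adjoin R {g, z}) (htop : adjoin R {x1, x2, u1, u2, g, gi, z} = ⊤) :
    span R (Set.range fun i : Fin 2 × Fin p × Fin (2 * p) × Fin p × Fin p × Fin 2 × Fin p ×
        Fin (2 * p) =>
      x1 ^ (i.1 : ℕ) * (x1 * x2 + x2 * x1) ^ (i.2.1 : ℕ) * x2 ^ (i.2.2.1 : ℕ) *
        g ^ (i.2.2.2.1 : ℕ) * z ^ (i.2.2.2.2.1 : ℕ) * u1 ^ (i.2.2.2.2.2.1 : ℕ) *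
        (u1 * u2 + u2 * u1) ^ (i.2.2.2.2.2.2.1 : ℕ) * u2 ^ (i.2.2.2.2.2.2.2 : ℕ)) = ⊤ := by
  have hp' : 0 < 2 * p := by omega
  rw [_root_.eq_top_iff, ← h.adjoin_mul_adjoin_mul_adjoin_eq_top hgi htop]
  calc _ ≤ powSpan R x1 2 * powSpan R (x1 * x2 + x2 * x1) p * powSpan R x2 (2 * p) *
          (powSpan R g p * powSpan R z p) *
          (powSpan R u1 2 * powSpan R (u1 * u2 + u2 * u1) p * powSpan R u2 (2 * p)) := by
        gcongr
        · exact adjoin_jordan_le hp hp' h.x1sq h.x2x21 hx21 hx2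
        · exact adjoin_commute_le hp hp h.zg hg hz
        · exact adjoin_jordan_le hp hp' h.u1sq h.u2u21 hu21 hu2
    _ ≤ _ := by
        simp only [powSpan, span_mul_span]
        refine span_mono ?_
        rintro _ ⟨_, ⟨_, ⟨_, ⟨_, ⟨a, rfl⟩, _, ⟨b, rfl⟩, rfl⟩, _, ⟨c, rfl⟩, rfl⟩, _,
          ⟨_, ⟨n, rfl⟩, _, ⟨j, rfl⟩, rfl⟩, rfl⟩, _,
          ⟨_, ⟨_, ⟨m, rfl⟩, _, ⟨e, rfl⟩, rfl⟩, _, ⟨f, rfl⟩, rfl⟩, rfl⟩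
        exact ⟨(a, b, c, n, j, m, e, f), by simp only [mul_assoc]⟩

end DoubleRel

end DoubleSpanning

/-- The relations satisfied by `x1, x2, u1, u21, g, g', ζ`. They present the subalgebra of `D~`
over which `D~` is an Ore extension with variable `u2`. -/
structure OreBaseRel {P : Type*} [Ring P] (x1 x2 u1 s g gi z : P) : Prop where
  x1sq : x1 * x1 = 0
  x2x21 : x2 * (x1 * x2 + x2 * x1) = (x1 * x2 + x2 * x1) * x2 + x1 * (x1 * x2 + x2 * x1)
  u1sq : u1 * u1 = 0
  ggi : g * gi = 1
  gig : gi * g = 1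
  zg : z * g = g * z
  gx1 : g * x1 = x1 * g
  gx2 : g * x2 = x2 * g - x1 * g
  u1g : u1 * g = g * u1
  sg : s * g = g * s
  zx1 : z * x1 = x1 * z + x1
  zx2 : z * x2 = x2 * z + x2
  u1z : u1 * z = z * u1 + u1
  sz : s * z = z * s + 2 * s
  u1x1 : u1 * x1 = -(x1 * u1)
  u1x2 : u1 * x2 = -(x2 * u1) + 1 - g
  sx1 : s * x1 = x1 * s
  sx2 : s * x2 = x2 * s + (1 + g) * u1
  su1 : s * u1 = u1 * s

section DifferentialOperators

variable {k K : Type*} [CommRing k] [CommRing K] [Algebra k K]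

/-- The operator `x1` on `K ⊕ K x1 ⊕ K u1 ⊕ K x1 u1`. -/
def x1Op (k : Type*) {K : Type*} [CommRing k] [CommRing K] [Algebra k K] :
    Module.End k (K × K × K × K) where
  toFun v := (0, v.1, 0, v.2.2.1)
  map_add' v w := by simp
  map_smul' c v := by simp

/-- The operator `u1`. -/
def u1Op (k : Type*) {K : Type*} [CommRing k] [CommRing K] [Algebra k K] :
    Module.End k (K × K × K × K) where
  toFun v := (0, 0, v.1, -v.2.1)
  map_add' v w := by simp [add_comm]
  map_smul' c v := by simp

/-- The operator `x2`, where `y` is the diagonal part and `a`, `ds` are derivations. -/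
def x2Op (t y g : K) (a ds : Derivation k K K) : Module.End k (K × K × K × K) where
  toFun v := (y * v.1 + t * v.2.1 + (1 - g) * v.2.2.1,
    a v.1 - y * v.2.1 - (1 - g) * v.2.2.2,
    t * v.2.2.2 - y * v.2.2.1 - (1 + g) * ds v.1,
    y * v.2.2.2 + a v.2.2.1 + (1 + g) * ds v.2.1)
  map_add' v w := by
    ext <;> simp <;> ring
  map_smul' c v := by
    ext <;> simp [Algebra.smul_def] <;> ring

/-- The operator `ζ`. -/
def zOp (z : K) (e : Derivation k K K) : Module.End k (K × K × K × K) where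
  toFun v := (e v.1 + z * v.1, e v.2.1 + v.2.1 + z * v.2.1, e v.2.2.1 - v.2.2.1 + z * v.2.2.1,
    e v.2.2.2 + z * v.2.2.2)
  map_add' v w := by
    ext <;> simp <;> ring
  map_smul' c v := by
    ext <;> simp [Algebra.smul_def] <;> ring

theorem oreBaseRel_operators {t s y g gi z : K} {a ds e : Derivation k K K} (hg : g * gi = 1)
    (hat : a t = t) (hay : a y = 0) (hag : a g = g) (hdt : ds t = 0) (hds : ds s = 1)
    (hdy : ds y = 0) (hdg : ds g = 0) (het : e t = 2 * t) (hes : e s = -2 * s) (hey : e y = y)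
    (heg : e g = 0) (haz : a z = 0) (hdz : ds z = 0) (has : a s = 0)
    (hads : ∀ v, a (ds v) = ds (a v)) (hea : ∀ v, e (a v) = a (e v))
    (heds : ∀ v, e (ds v) = ds (e v) + 2 * ds v) :
    OreBaseRel (x1Op k) (x2Op t y g a ds) (u1Op k) (Algebra.lsmul k k (K × K × K × K) s)
      (Algebra.lsmul k k (K × K × K × K) g) (Algebra.lsmul k k (K × K × K × K) gi) (zOp z e) := by
  constructor
  case ggi => rw [← map_mul, hg, map_one]
  case gig => rw [← map_mul, mul_comm, hg, map_one]
  all_goals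
    refine LinearMap.ext fun ⟨v₁, v₂, v₃, v₄⟩ => ?_
    simp only [Module.End.mul_apply, LinearMap.add_apply, LinearMap.sub_apply, LinearMap.neg_apply,
      x1Op, x2Op, u1Op, zOp, LinearMap.coe_mk, AddHom.coe_mk, Algebra.lsmul_coe, Prod.smul_mk,
      smul_eq_mul, Module.End.one_apply, LinearMap.zero_apply, two_mul, Prod.mk_add_mk,
      Prod.mk_sub_mk, Prod.neg_mk, map_zero, map_add, map_sub, map_neg, Derivation.leibniz,
      Derivation.map_one_eq_zero, hat, hay, hag, hdt, hds, hdy, hdg, het, hes, hey, heg, haz,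
      hdz, has, hads, hea, heds]
    ext <;> simp <;> ring

end DifferentialOperators

section Grading

open AddMonoidAlgebra

variable (k : Type*) {A M : Type*} [CommRing k] [CommRing A] [Algebra k A] [AddCommMonoid M]

/-- The linear map multiplying the component of degree `m` of a monoid algebra by `χ m`. -/
noncomputable def gradingLinearMap (χ : M →+ ℤ) : A[M] →ₗ[k] A[M] :=
  Finsupp.lsum k (fun m => (χ m) • AddMonoidAlgebra.lsingle m) ∘ₗ
      (AddMonoidAlgebra.coeffLinearEquiv k : A[M] ≃ₗ[k] M →₀ A).toLinearMap

theorem gradingLinearMap_single (χ : M →+ ℤ) (m : M) (c : A) :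
    gradingLinearMap k χ (single m c) = χ m • single m c := by
  have h : (AddMonoidAlgebra.coeffLinearEquiv k : A[M] ≃ₗ[k] M →₀ A) (single m c) =
      Finsupp.single m c := rfl
  rw [gradingLinearMap, LinearMap.comp_apply, LinearEquiv.coe_coe, h, Finsupp.lsum_single,
    LinearMap.smul_apply]
  rfl

/-- The derivation of a monoid algebra multiplying the component of degree `m` by `χ m`. -/
noncomputable def gradingDerivation (χ : M →+ ℤ) : Derivation k A[M] A[M] :=
  Derivation.mk' (gradingLinearMap k χ) <| by
    intro x y
    induction x using AddMonoidAlgebra.induction_linear with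
    | zero => simp
    | add x x' hx hx' => simp only [add_mul, map_add, hx, hx', add_smul, smul_add]; abel
    | single m c =>
      induction y using AddMonoidAlgebra.induction_linear with
      | zero => simp
      | add y y' hy hy' => simp only [mul_add, map_add, hy, hy', add_smul, smul_add]; abel
      | single n d =>
        simp only [single_mul_single, gradingLinearMap_single, map_add, smul_eq_mul,
          mul_smul_comm, add_smul]
        rw [add_comm n m, mul_comm d c, add_comm]

theorem gradingDerivation_single (χ : M →+ ℤ) (m : M) (c : A) :
    gradingDerivation k χ (single m c) = χ m • single m c :=
  gradingLinearMap_single k χ m c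

theorem gradingDerivation_comm (χ φ : M →+ ℤ) (v : A[M]) :
    gradingDerivation k χ (gradingDerivation k φ v) =
      gradingDerivation k φ (gradingDerivation k χ v) := by
  induction v using AddMonoidAlgebra.induction_linear with
  | zero => simp
  | add x x' hx hx' => simp only [map_add, hx, hx']
  | single m c => simp only [gradingDerivation_single, map_zsmul, smul_comm (χ m)]

end Grading

section LaurentModel

open AddMonoidAlgebra

variable (k : Type*) [Field k]

/-- Exponents of `x21`, `u21`, `x2` and `g`. -/
abbrev LaurentExp := ℤ × ℤ × ℤ × ℤ

/-- Laurent polynomials in `x21`, `u21`, `x2`, `g` with coefficients in `k[ζ]`. -/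
abbrev LaurentRing := AddMonoidAlgebra (Polynomial k) LaurentExp

/-- The weight homomorphism with the given values on the variables. -/
def weightHom (a b c d : ℤ) : LaurentExp →+ ℤ :=
  AddMonoidHom.mk' (fun m => a * m.1 + b * m.2.1 + c * m.2.2.1 + d * m.2.2.2)
    (fun m n => by simp only [Prod.fst_add, Prod.snd_add]; ring)

@[simp]
theorem weightHom_apply (a b c d : ℤ) (m : LaurentExp) :
    weightHom a b c d m = a * m.1 + b * m.2.1 + c * m.2.2.1 + d * m.2.2.2 := rfl

/-- The derivation `t ∂/∂t + g ∂/∂g`. -/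
noncomputable def shiftDerivation : Derivation k (LaurentRing k) (LaurentRing k) :=
  gradingDerivation k (weightHom 1 0 0 1)

/-- The derivation `∂/∂s`. -/
noncomputable def lowerDerivation : Derivation k (LaurentRing k) (LaurentRing k) :=
  (single (0, -1, 0, 0) 1 : LaurentRing k) • gradingDerivation k (weightHom 0 1 0 0)

/-- The derivation `2 t ∂/∂t - 2 s ∂/∂s + y ∂/∂y`. -/
noncomputable def eulerDerivation : Derivation k (LaurentRing k) (LaurentRing k) :=
  gradingDerivation k (weightHom 2 (-2) 1 0)

/-- The action of `x2` on the Laurent model. -/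
noncomputable abbrev laurentX2 :
    Module.End k (LaurentRing k × LaurentRing k × LaurentRing k × LaurentRing k) :=
  x2Op (single (1, 0, 0, 0) 1) (single (0, 0, 1, 0) 1) (single (0, 0, 0, 1) 1)
    (shiftDerivation k) (lowerDerivation k)

/-- The action of `ζ` on the Laurent model. -/
noncomputable abbrev laurentZ :
    Module.End k (LaurentRing k × LaurentRing k × LaurentRing k × LaurentRing k) :=
  zOp (single 0 Polynomial.X) (eulerDerivation k)

/-- The action of a Laurent monomial. -/
noncomputable abbrev laurentMul (m : LaurentExp) :
    Module.End k (LaurentRing k × LaurentRing k × LaurentRing k × LaurentRing k) :=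
  Algebra.lsmul k k _ (single m 1 : LaurentRing k)

theorem laurent_oreBaseRel :
    OreBaseRel (x1Op k) (laurentX2 k) (u1Op k) (laurentMul k (0, 1, 0, 0))
      (laurentMul k (0, 0, 0, 1)) (laurentMul k (0, 0, 0, -1)) (laurentZ k) := by
  have two_single : ∀ m : LaurentExp,
      (single m 2 : LaurentRing k) = 2 * single m 1 := fun m => by
    rw [two_mul, ← single_add, one_add_one_eq_two]
  have hads : ∀ v, shiftDerivation k (lowerDerivation k v) =
      lowerDerivation k (shiftDerivation k v) := by
    intro v
    simp only [lowerDerivation, shiftDerivation, Derivation.smul_apply, smul_eq_mul,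
      Derivation.leibniz, gradingDerivation_single, gradingDerivation_comm k (weightHom 0 1 0 0)]
    simp
  have heds : ∀ v, eulerDerivation k (lowerDerivation k v) =
      lowerDerivation k (eulerDerivation k v) + 2 * lowerDerivation k v := by
    intro v
    simp only [lowerDerivation, eulerDerivation, Derivation.smul_apply, smul_eq_mul,
      Derivation.leibniz, gradingDerivation_single, gradingDerivation_comm k (weightHom 0 1 0 0)]
    simp [-zsmul_eq_mul, two_single]
    ring
  apply oreBaseRel_operators
  case hads => exact hads
  case heds => exact heds
  case hes =>
    simp [eulerDerivation, gradingDerivation_single, two_single]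
    ring
  case hea => exact gradingDerivation_comm k _ _
  all_goals
    simp [shiftDerivation, lowerDerivation, eulerDerivation, gradingDerivation_single,
      single_mul_single, two_single, AddMonoidAlgebra.one_def]
  all_goals rfl

end LaurentModel

namespace OreBaseRel

variable {P : Type*} [Ring P] {x1 x2 u1 s g gi z : P}

theorem u1_mul_gi (h : OreBaseRel x1 x2 u1 s g gi z) : u1 * gi = gi * u1 :=
  calc u1 * gi = gi * g * u1 * gi := by rw [h.gig, one_mul]
    _ = gi * u1 := by rw [mul_assoc gi, ← h.u1g, mul_assoc, mul_assoc, h.ggi, mul_one]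

end OreBaseRel

section UpperTriangular

variable {P : Type*} [Ring P]

/-- The upper triangular matrix with rows `(a, b)` and `(0, c)`. -/
def upperTri (a b c : P) : Matrix (Fin 2) (Fin 2) P := !![a, b; 0, c]

theorem upperTri_mul (a b c a' b' c' : P) :
    upperTri a b c * upperTri a' b' c' = upperTri (a * a') (a * b' + b * c') (c * c') := by
  simp [upperTri]

theorem upperTri_add (a b c a' b' c' : P) :
    upperTri a b c + upperTri a' b' c' = upperTri (a + a') (b + b') (c + c') := by
  simp [upperTri]

theorem upperTri_sub (a b c a' b' c' : P) :
    upperTri a b c - upperTri a' b' c' = upperTri (a - a') (b - b') (c - c') := by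
  simp [upperTri]

theorem upperTri_neg (a b c : P) : -upperTri a b c = upperTri (-a) (-b) (-c) := by
  simp [upperTri]

theorem upperTri_one : (1 : Matrix (Fin 2) (Fin 2) P) = upperTri 1 0 1 :=
  Matrix.one_fin_two

theorem upperTri_zero : (0 : Matrix (Fin 2) (Fin 2) P) = upperTri 0 0 0 := by
  ext i j; fin_cases i <;> fin_cases j <;> rfl

theorem OreBaseRel.upperTri {x1 x2 u1 s g gi z : P} (h : OreBaseRel x1 x2 u1 s g gi z) :
    OreBaseRel (upperTri (-x1) (1 - g + x1 * u1) x1) (upperTri (-x2) (g * z + x2 * u1) x2)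
      (upperTri (-u1) s u1) (upperTri s (u1 * s) s) (upperTri g (-(g * u1)) g)
      (upperTri gi (u1 * gi) gi) (upperTri (z + 1) 0 z) := by
  have r := h.u1_mul_gi
  have j := jordan_rewrite h.x1sq h.x2x21
  have j' : ∀ d, x2 * (x2 * (x1 * d)) = (x1 * (x2 * x2) + x1 * (x2 * x1)) * d := fun d => by
    rw [← j]; simp only [mul_assoc]
  constructor
  all_goals
    simp only [two_mul, upperTri_one, upperTri_zero, upperTri_mul, upperTri_add, upperTri_sub,
      upperTri_neg]
    congr 1
  all_goals
    simp only [mul_add, add_mul, mul_sub, sub_mul, mul_neg, neg_mul, mul_one, one_mul, mul_zero,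
      zero_mul, mul_assoc, neg_neg, neg_zero, add_zero, zero_add, two_mul,
      h.x1sq, h.u1sq, h.ggi, h.gig, h.zg, h.gx1, h.gx2, h.u1g, h.sg, h.zx1, h.zx2, h.u1z, h.sz,
      h.u1x1, h.u1x2, h.sx1, h.sx2, h.su1, r, j, j',
      mul_mul_of_mul_eq h.x1sq, mul_mul_of_mul_eq h.u1sq, mul_mul_of_mul_eq h.ggi,
      mul_mul_of_mul_eq h.gig, mul_mul_of_mul_eq h.zg, mul_mul_of_mul_eq h.gx1,
      mul_mul_of_mul_eq h.gx2, mul_mul_of_mul_eq h.u1g, mul_mul_of_mul_eq h.sg,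
      mul_mul_of_mul_eq h.zx1, mul_mul_of_mul_eq h.zx2, mul_mul_of_mul_eq h.u1z,
      mul_mul_of_mul_eq h.u1x1, mul_mul_of_mul_eq h.u1x2,
      mul_mul_of_mul_eq h.sx1, mul_mul_of_mul_eq h.sx2]
    try abel

end UpperTriangular

section OreBase

variable (k : Type) [Field k]

/-- The relations `OreBaseRel` on the free algebra on `x1, x2, u1, s, g, g', ζ`. -/
inductive OreBasePresentation : FreeAlgebra k (Fin 7) → FreeAlgebra k (Fin 7) → Prop
  | x1sq : OreBasePresentation (.ι k 0 * .ι k 0) 0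
  | x2x21 : OreBasePresentation (.ι k 1 * (.ι k 0 * .ι k 1 + .ι k 1 * .ι k 0))
      ((.ι k 0 * .ι k 1 + .ι k 1 * .ι k 0) * .ι k 1 +
        .ι k 0 * (.ι k 0 * .ι k 1 + .ι k 1 * .ι k 0))
  | u1sq : OreBasePresentation (.ι k 2 * .ι k 2) 0
  | ggi : OreBasePresentation (.ι k 4 * .ι k 5) 1
  | gig : OreBasePresentation (.ι k 5 * .ι k 4) 1
  | zg : OreBasePresentation (.ι k 6 * .ι k 4) (.ι k 4 * .ι k 6)
  | gx1 : OreBasePresentation (.ι k 4 * .ι k 0) (.ι k 0 * .ι k 4)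
  | gx2 : OreBasePresentation (.ι k 4 * .ι k 1) (.ι k 1 * .ι k 4 - .ι k 0 * .ι k 4)
  | u1g : OreBasePresentation (.ι k 2 * .ι k 4) (.ι k 4 * .ι k 2)
  | sg : OreBasePresentation (.ι k 3 * .ι k 4) (.ι k 4 * .ι k 3)
  | zx1 : OreBasePresentation (.ι k 6 * .ι k 0) (.ι k 0 * .ι k 6 + .ι k 0)
  | zx2 : OreBasePresentation (.ι k 6 * .ι k 1) (.ι k 1 * .ι k 6 + .ι k 1)
  | u1z : OreBasePresentation (.ι k 2 * .ι k 6) (.ι k 6 * .ι k 2 + .ι k 2)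
  | sz : OreBasePresentation (.ι k 3 * .ι k 6) (.ι k 6 * .ι k 3 + 2 * .ι k 3)
  | u1x1 : OreBasePresentation (.ι k 2 * .ι k 0) (-(.ι k 0 * .ι k 2))
  | u1x2 : OreBasePresentation (.ι k 2 * .ι k 1) (-(.ι k 1 * .ι k 2) + 1 - .ι k 4)
  | sx1 : OreBasePresentation (.ι k 3 * .ι k 0) (.ι k 0 * .ι k 3)
  | sx2 : OreBasePresentation (.ι k 3 * .ι k 1) (.ι k 1 * .ι k 3 + (1 + .ι k 4) * .ι k 2)
  | su1 : OreBasePresentation (.ι k 3 * .ι k 2) (.ι k 2 * .ι k 3)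

/-- The algebra presented by `OreBaseRel`. -/
def OreBase := RingQuot (OreBasePresentation k)

noncomputable instance : Ring (OreBase k) := inferInstanceAs (Ring (RingQuot _))

noncomputable instance : Algebra k (OreBase k) := inferInstanceAs (Algebra k (RingQuot _))

/-- The projection onto the quotient. -/
noncomputable def OreBase.mk : FreeAlgebra k (Fin 7) →ₐ[k] OreBase k :=
  RingQuot.mkAlgHom k (OreBasePresentation k)

theorem OreBase.mk_eq {a b : FreeAlgebra k (Fin 7)} (h : OreBasePresentation k a b) :
    OreBase.mk k a = OreBase.mk k b :=
  RingQuot.mkAlgHom_rel k h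

/-- The generators of `OreBase`. -/
noncomputable def oreGen (i : Fin 7) : OreBase k :=
  OreBase.mk k (.ι k i)

theorem oreBaseRel_oreGen :
    OreBaseRel (oreGen k 0) (oreGen k 1) (oreGen k 2) (oreGen k 3) (oreGen k 4) (oreGen k 5)
      (oreGen k 6) := by
  have H := @OreBase.mk_eq k _
  constructor
  · simpa [oreGen] using H .x1sq
  · simpa [oreGen] using H .x2x21
  · simpa [oreGen] using H .u1sq
  · simpa [oreGen] using H .ggi
  · simpa [oreGen] using H .gig
  · simpa [oreGen] using H .zg
  · simpa [oreGen] using H .gx1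
  · simpa [oreGen] using H .gx2
  · simpa [oreGen] using H .u1g
  · simpa [oreGen] using H .sg
  · simpa [oreGen] using H .zx1
  · simpa [oreGen] using H .zx2
  · simpa [oreGen] using H .u1z
  · simpa [oreGen, two_mul] using H .sz
  · simpa [oreGen] using H .u1x1
  · simpa [oreGen] using H .u1x2
  · simpa [oreGen] using H .sx1
  · simpa [oreGen] using H .sx2
  · simpa [oreGen] using H .su1

theorem RingQuot.adjoin_range_mkAlgHom_ι {k X : Type*} [CommRing k]
    (r : FreeAlgebra k X → FreeAlgebra k X → Prop) :
    Algebra.adjoin k (Set.range fun i => RingQuot.mkAlgHom k r (.ι k i)) = ⊤ := by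
  have h : (Set.range fun i => RingQuot.mkAlgHom k r (.ι k i)) =
      RingQuot.mkAlgHom k r '' Set.range (FreeAlgebra.ι k) := by
    rw [← Set.range_comp]; rfl
  rw [h, ← AlgHom.map_adjoin, FreeAlgebra.adjoin_range_ι, Algebra.map_top,
    AlgHom.range_eq_top]
  exact RingQuot.mkAlgHom_surjective k r

theorem adjoin_oreGen : Algebra.adjoin k (Set.range (oreGen k)) = ⊤ :=
  RingQuot.adjoin_range_mkAlgHom_ι (OreBasePresentation k)

variable {k} {A : Type*} [Ring A] [Algebra k A]

/-- The homomorphism out of `OreBase` given by elements satisfying the relations. -/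
noncomputable def OreBaseRel.lift {x1 x2 u1 s g gi z : A} (h : OreBaseRel x1 x2 u1 s g gi z) :
    OreBase k →ₐ[k] A :=
  RingQuot.liftAlgHom k ⟨FreeAlgebra.lift k ![x1, x2, u1, s, g, gi, z], by
    rintro _ _ (_ | _)
    all_goals simp only [map_mul, map_add, map_sub, map_neg, map_one, map_zero, map_ofNat,
      FreeAlgebra.lift_ι_apply]
    · exact h.x1sq
    · exact h.x2x21
    · exact h.u1sq
    · exact h.ggi
    · exact h.gig
    · exact h.zg
    · exact h.gx1
    · exact h.gx2
    · exact h.u1g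
    · exact h.sg
    · exact h.zx1
    · exact h.zx2
    · exact h.u1z
    · exact h.sz
    · exact h.u1x1
    · exact h.u1x2
    · exact h.sx1
    · exact h.sx2
    · exact h.su1⟩

theorem OreBaseRel.lift_oreGen {x1 x2 u1 s g gi z : A} (h : OreBaseRel x1 x2 u1 s g gi z)
    (i : Fin 7) : h.lift (oreGen k i) = ![x1, x2, u1, s, g, gi, z] i :=
  (RingQuot.liftAlgHom_mkAlgHom_apply k _ _ _).trans (FreeAlgebra.lift_ι_apply _ _)

variable (k)

/-- The homomorphism `r ↦ (σ r, δ r; 0, r)` encoding the Ore extension data of `u2`. -/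
noncomputable def oreMatrix : OreBase k →ₐ[k] Matrix (Fin 2) (Fin 2) (OreBase k) :=
  (oreBaseRel_oreGen k).upperTri.lift

/-- The automorphism of the Ore extension. -/
noncomputable def oreSigma : OreBase k →ₗ[k] OreBase k :=
  Matrix.entryLinearMap k (OreBase k) 0 0 ∘ₗ (oreMatrix k).toLinearMap

/-- The skew derivation of the Ore extension. -/
noncomputable def oreDelta : OreBase k →ₗ[k] OreBase k :=
  Matrix.entryLinearMap k (OreBase k) 0 1 ∘ₗ (oreMatrix k).toLinearMap

theorem oreMatrix_apply (r : OreBase k) :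
    oreMatrix k r = upperTri (oreSigma k r) (oreDelta k r) r := by
  have h : oreMatrix k r 1 0 = 0 ∧ oreMatrix k r 1 1 = r := by
    have hr : r ∈ Algebra.adjoin k (Set.range (oreGen k)) :=
      (adjoin_oreGen k).symm ▸ Algebra.mem_top
    induction hr using Algebra.adjoin_induction with
    | mem x hx =>
      obtain ⟨i, rfl⟩ := hx
      rw [oreMatrix, OreBaseRel.lift_oreGen]
      fin_cases i <;> exact ⟨rfl, rfl⟩
    | algebraMap c => simp [Matrix.algebraMap_matrix_apply]
    | add x y _ _ hx hy => simp [hx, hy]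
    | mul x y _ _ hx hy => simp [hx, hy, Matrix.mul_apply]
  ext i j
  fin_cases i <;> fin_cases j
  · rfl
  · rfl
  · exact h.1
  · exact h.2

theorem oreSigma_mul (r r' : OreBase k) : oreSigma k (r * r') = oreSigma k r * oreSigma k r' := by
  have h := congrFun (congrFun (map_mul (oreMatrix k) r r') 0) 0
  rwa [oreMatrix_apply, oreMatrix_apply, oreMatrix_apply, upperTri_mul] at h

theorem oreDelta_mul (r r' : OreBase k) :
    oreDelta k (r * r') = oreSigma k r * oreDelta k r' + oreDelta k r * r' := by
  have h := congrFun (congrFun (map_mul (oreMatrix k) r r') 0) 1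
  rwa [oreMatrix_apply, oreMatrix_apply, oreMatrix_apply, upperTri_mul] at h

theorem oreMatrix_eq {r a b : OreBase k} (h : oreMatrix k r = upperTri a b r) :
    oreSigma k r = a ∧ oreDelta k r = b :=
  ⟨congrFun (congrFun h 0) 0, congrFun (congrFun h 0) 1⟩

end OreBase

theorem OreBaseRel.doubleRel_of_skew {P E : Type*} [Ring P] [Ring E] {x1 x2 u1 s g gi z : P}
    (h : OreBaseRel x1 x2 u1 s g gi z) (L : P →+* E) {u2 : E}
    (hx1 : u2 * L x1 = L (-x1) * u2 + L (1 - g + x1 * u1))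
    (hx2 : u2 * L x2 = L (-x2) * u2 + L (g * z + x2 * u1))
    (hu1 : u2 * L u1 = L (-u1) * u2 + L s)
    (hs : u2 * L s = L s * u2 + L (u1 * s))
    (hg : u2 * L g = L g * u2 + L (-(g * u1)))
    (hz : u2 * L z = L (z + 1) * u2 + L 0) :
    DoubleRel (L x1) (L x2) (L u1) u2 (L g) (L gi) (L z) ∧ L u1 * u2 + u2 * L u1 = L s := by
  have hs' : L u1 * u2 + u2 * L u1 = L s := by
    rw [hu1, map_neg]; noncomm_ring
  refine ⟨⟨?_, ?_, ?_, ?_, ?_, ?_, ?_, ?_, ?_, ?_, ?_, ?_, ?_, ?_, ?_, ?_, ?_, ?_, ?_⟩, hs'⟩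
  case refine_4 => rw [hs', hs, map_mul]
  case refine_11 => rw [hg]; simp [sub_eq_add_neg]
  case refine_15 => rw [hz]; simp [add_mul]
  case refine_18 => rw [hx1]; simp only [map_add, map_sub, map_neg, map_mul, map_one]; noncomm_ring
  case refine_19 => rw [hx2]; simp only [map_add, map_neg, map_mul, neg_mul, add_assoc]
  all_goals simp only [← map_mul, ← map_add, ← map_sub, ← map_neg, ← map_one L, ← map_zero L]
  · rw [h.x1sq]
  · rw [h.x2x21]
  · rw [h.u1sq]
  · rw [h.ggi]
  · rw [h.gig]
  · rw [h.zg]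
  · rw [h.gx1]
  · rw [h.gx2]
  · rw [h.u1g]
  · rw [h.zx1]
  · rw [h.zx2]
  · rw [h.u1z]
  · rw [h.u1x1]
  · rw [h.u1x2]

section OreExtension

variable (k : Type) [Field k]

/-- Left multiplication on polynomials in `u2` with left coefficients in `OreBase`. -/
noncomputable def oreLeft : OreBase k →ₐ[k] Module.End k (ℕ →₀ OreBase k) where
  toFun w := Finsupp.mapRange.linearMap (LinearMap.mulLeft k w)
  map_one' := Finsupp.lhom_ext fun i r => by simp
  map_mul' a b := Finsupp.lhom_ext fun i r => by
    simp only [Finsupp.mapRange.linearMap_apply, Finsupp.mapRange_single, LinearMap.mulLeft_apply,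
      Module.End.mul_apply, mul_assoc]
  map_zero' := Finsupp.lhom_ext fun i r => by simp
  map_add' a b := Finsupp.lhom_ext fun i r => by simp [add_mul]
  commutes' c := Finsupp.lhom_ext fun i r => by simp [Algebra.algebraMap_eq_smul_one]

theorem oreLeft_single (w : OreBase k) (i : ℕ) (r : OreBase k) :
    oreLeft k w (Finsupp.single i r) = Finsupp.single i (w * r) := by
  simp [oreLeft]

/-- Left multiplication by `u2`. -/
noncomputable def oreVar : Module.End k (ℕ →₀ OreBase k) :=
  Finsupp.lsum k fun i => Finsupp.lsingle (i + 1) ∘ₗ oreSigma k + Finsupp.lsingle i ∘ₗ oreDelta k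

theorem oreVar_single (i : ℕ) (r : OreBase k) :
    oreVar k (Finsupp.single i r) =
      Finsupp.single (i + 1) (oreSigma k r) + Finsupp.single i (oreDelta k r) := by
  simp [oreVar]

theorem oreVar_mul_oreLeft (w : OreBase k) :
    oreVar k * oreLeft k w = oreLeft k (oreSigma k w) * oreVar k + oreLeft k (oreDelta k w) := by
  refine Finsupp.lhom_ext fun i r => ?_
  simp only [Module.End.mul_apply, LinearMap.add_apply, oreLeft_single, oreVar_single, map_add,
    oreSigma_mul, oreDelta_mul, Finsupp.single_add, add_assoc]

theorem doubleRel_ore :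
    DoubleRel (oreLeft k (oreGen k 0)) (oreLeft k (oreGen k 1)) (oreLeft k (oreGen k 2)) (oreVar k)
      (oreLeft k (oreGen k 4)) (oreLeft k (oreGen k 5)) (oreLeft k (oreGen k 6)) ∧
    oreLeft k (oreGen k 2) * oreVar k + oreVar k * oreLeft k (oreGen k 2) =
      oreLeft k (oreGen k 3) := by
  have h := oreBaseRel_oreGen k
  have hv : ∀ i : Fin 7, oreMatrix k (oreGen k i) = _ := h.upperTri.lift_oreGen
  have e : ∀ (i : Fin 7) (a b : OreBase k), oreMatrix k (oreGen k i) = upperTri a b (oreGen k i) →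
      oreVar k * oreLeft k (oreGen k i) = oreLeft k a * oreVar k + oreLeft k b := by
    intro i a b hi
    rw [oreVar_mul_oreLeft, (oreMatrix_eq k hi).1, (oreMatrix_eq k hi).2]
  have e0 := e 0 _ _ (hv 0)
  have e1 := e 1 _ _ (hv 1)
  have e2 := e 2 _ _ (hv 2)
  have e3 := e 3 _ _ (hv 3)
  have e4 := e 4 _ _ (hv 4)
  have e6 := e 6 _ _ (hv 6)
  have skew := h.doubleRel_of_skew (E := Module.End k (ℕ →₀ OreBase k)) (oreLeft k : _ →+* _)
    (u2 := oreVar k)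
  exact skew e0 e1 e2 e3 e4 e6

end OreExtension

namespace SuperJordanDouble

section Presentation

variable (k : Type) [Field k]

theorem doubleRel_tD : DoubleRel (x1 k) (x2 k) (u1 k) (u2 k) (g k) (gi k) (z k) := by
  have H := @RingQuot.mkAlgHom_rel k _ _ _ _ (Rel k)
  constructor
  · simpa [x1] using H .x1sq
  · simpa [x1, x2, fx21] using H .x2x21
  · simpa [u1] using H .u1sq
  · simpa [u1, u2, fu21] using H .u2u21
  · simpa [g, gi] using H .ggi
  · simpa [g, gi] using H .gig
  · simpa [g, z] using H .zg
  · simpa [g, x1] using H .gx1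
  · simpa [g, x1, x2] using H .gx2
  · simpa [g, u1] using H .u1g
  · simpa [g, u1, u2] using H .u2g
  · simpa [z, x1] using H .zx1
  · simpa [z, x2] using H .zx2
  · simpa [z, u1] using H .u1z
  · simpa [z, u2] using H .u2z
  · simpa [x1, u1] using H .u1x1
  · simpa [x2, u1, g] using H .u1x2
  · simpa [x1, u1, u2, g] using H .u2x1
  · simpa [x2, u1, u2, g, z] using H .u2x2

theorem adjoin_generators_eq_top :
    Algebra.adjoin k {x1 k, x2 k, u1 k, u2 k, g k, gi k, z k} = ⊤ := by
  rw [← RingQuot.adjoin_range_mkAlgHom_ι (Rel k)]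
  congr 1
  ext d
  simp only [Set.mem_insert_iff, Set.mem_singleton_iff, Set.mem_range, Fin.exists_fin_succ,
    eq_comm (a := d)]
  simp [x1, x2, u1, u2, g, gi, z, fx1, fx2, fu1, fu2, fg, fgi, fz]

variable {k} {A : Type*} [Ring A] [Algebra k A] {X1 X2 U1 U2 G G' Z : A}

/-- The homomorphism out of `D~` given by elements satisfying the relations. -/
noncomputable def lift (h : DoubleRel X1 X2 U1 U2 G G' Z) : tD k →ₐ[k] A :=
  RingQuot.liftAlgHom k ⟨FreeAlgebra.lift k ![X1, X2, U1, U2, G, G', Z], by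
    rintro _ _ (_ | _)
    all_goals simp only [fx21, fu21, fx1, fx2, fu1, fu2, fg, fgi, fz, map_mul, map_add, map_sub,
      map_neg, map_one, map_zero, FreeAlgebra.lift_ι_apply]
    · exact h.x1sq
    · exact h.x2x21
    · exact h.u1sq
    · exact h.u2u21
    · exact h.ggi
    · exact h.gig
    · exact h.zg
    · exact h.gx1
    · exact h.gx2
    · exact h.u1g
    · exact h.u2g
    · exact h.zx1
    · exact h.zx2
    · exact h.u1z
    · exact h.u2z
    · exact h.u1x1
    · exact h.u1x2
    · exact h.u2x1
    · exact h.u2x2⟩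

theorem lift_generators (h : DoubleRel X1 X2 U1 U2 G G' Z) :
    lift h (x1 k) = X1 ∧ lift h (x2 k) = X2 ∧ lift h (u1 k) = U1 ∧ lift h (u2 k) = U2 ∧
      lift h (g k) = G ∧ lift h (gi k) = G' ∧ lift h (z k) = Z := by
  have e : ∀ i, lift h (RingQuot.mkAlgHom k (Rel k) (.ι k i)) = ![X1, X2, U1, U2, G, G', Z] i :=
    fun i => (RingQuot.liftAlgHom_mkAlgHom_apply k _ _ _).trans (FreeAlgebra.lift_ι_apply _ _)
  exact ⟨e 0, e 1, e 2, e 3, e 4, e 5, e 6⟩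

end Presentation

end SuperJordanDouble

namespace SuperJordanDouble

section Model

open AddMonoidAlgebra

variable (k : Type) [Field k]

/-- Four copies of the Laurent ring. -/
abbrev LaurentModel := LaurentRing k × LaurentRing k × LaurentRing k × LaurentRing k

/-- The representation of `D~` on polynomials in `u2` over the Ore base. -/
noncomputable def oreRep : tD k →ₐ[k] Module.End k (ℕ →₀ OreBase k) := lift (doubleRel_ore k).1

/-- The representation of the Ore base on the Laurent model. -/
noncomputable def laurentRep : OreBase k →ₐ[k] Module.End k (LaurentModel k) :=
  (laurent_oreBaseRel k).lift

/-- The symbol of an element of `D~`: a polynomial in `u2` with values in the Laurent model. -/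
noncomputable def laurentSymbol : tD k →ₗ[k] ℕ →₀ LaurentModel k :=
  Finsupp.mapRange.linearMap (LinearMap.applyₗ (single 0 1, 0, 0, 0) ∘ₗ (laurentRep k).toLinearMap)
    ∘ₗ LinearMap.applyₗ (Finsupp.single 0 1) ∘ₗ (oreRep k).toLinearMap

variable {k}

/-- The element `d` comes from the Ore base and acts on the Laurent model by `T`. -/
def ActsBy (d : tD k) (T : Module.End k (LaurentModel k)) : Prop :=
  ∃ w, oreRep k d = oreLeft k w ∧ laurentRep k w = T

namespace ActsBy

variable {d d' : tD k} {T T' : Module.End k (LaurentModel k)}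

theorem mul (h : ActsBy d T) (h' : ActsBy d' T') : ActsBy (d * d') (T * T') := by
  obtain ⟨w, h1, rfl⟩ := h
  obtain ⟨w', h1', rfl⟩ := h'
  exact ⟨w * w', by rw [map_mul, map_mul, h1, h1'], map_mul _ _ _⟩

theorem add (h : ActsBy d T) (h' : ActsBy d' T') : ActsBy (d + d') (T + T') := by
  obtain ⟨w, h1, rfl⟩ := h
  obtain ⟨w', h1', rfl⟩ := h'
  exact ⟨w + w', by rw [map_add, map_add, h1, h1'], map_add _ _ _⟩

theorem pow (h : ActsBy d T) (n : ℕ) : ActsBy (d ^ n) (T ^ n) := by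
  obtain ⟨w, h1, rfl⟩ := h
  exact ⟨w ^ n, by rw [map_pow, map_pow, h1], map_pow _ _ _⟩

theorem aeval (h : ActsBy d T) (P : Polynomial k) :
    ActsBy (Polynomial.aeval d P) (Polynomial.aeval T P) := by
  obtain ⟨w, h1, rfl⟩ := h
  exact ⟨Polynomial.aeval w P, by
    rw [← Polynomial.aeval_algHom_apply, h1, Polynomial.aeval_algHom_apply],
    (Polynomial.aeval_algHom_apply _ _ _).symm⟩

theorem laurentSymbol_mul (h : ActsBy d T) (y : tD k) :
    laurentSymbol k (d * y) = Finsupp.mapRange.linearMap T (laurentSymbol k y) := by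
  obtain ⟨w, h1, rfl⟩ := h
  ext1 i
  simp only [laurentSymbol, LinearMap.comp_apply, AlgHom.toLinearMap_apply, map_mul, h1,
    LinearMap.applyₗ_apply_apply, Module.End.mul_apply, Finsupp.mapRange.linearMap_apply,
    Finsupp.mapRange_apply]
  have : (oreLeft k w (oreRep k y (Finsupp.single 0 1))) i =
      w * (oreRep k y (Finsupp.single 0 1)) i := rfl
  rw [this, map_mul, Module.End.mul_apply]

theorem laurentSymbol_mul_single (h : ActsBy d T) {y : tD k} {i : ℕ} {v : LaurentModel k}
    (hy : laurentSymbol k y = Finsupp.single i v) :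
    laurentSymbol k (d * y) = Finsupp.single i (T v) := by
  rw [h.laurentSymbol_mul, hy, Finsupp.mapRange.linearMap_apply, Finsupp.mapRange_single]

end ActsBy

theorem actsBy_x1 : ActsBy (x1 k) (x1Op k) :=
  ⟨_, (lift_generators (doubleRel_ore k).1).1, (laurent_oreBaseRel k).lift_oreGen 0⟩

theorem actsBy_x2 : ActsBy (x2 k) (laurentX2 k) :=
  ⟨_, (lift_generators (doubleRel_ore k).1).2.1, (laurent_oreBaseRel k).lift_oreGen 1⟩

theorem actsBy_u1 : ActsBy (u1 k) (u1Op k) :=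
  ⟨_, (lift_generators (doubleRel_ore k).1).2.2.1, (laurent_oreBaseRel k).lift_oreGen 2⟩

theorem actsBy_g : ActsBy (g k) (laurentMul k (0, 0, 0, 1)) :=
  ⟨_, (lift_generators (doubleRel_ore k).1).2.2.2.2.1, (laurent_oreBaseRel k).lift_oreGen 4⟩

theorem actsBy_gi : ActsBy (gi k) (laurentMul k (0, 0, 0, -1)) :=
  ⟨_, (lift_generators (doubleRel_ore k).1).2.2.2.2.2.1, (laurent_oreBaseRel k).lift_oreGen 5⟩

theorem actsBy_z : ActsBy (z k) (laurentZ k) :=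
  ⟨_, (lift_generators (doubleRel_ore k).1).2.2.2.2.2.2, (laurent_oreBaseRel k).lift_oreGen 6⟩

theorem oreRep_u2 : oreRep k (u2 k) = oreVar k :=
  (lift_generators (doubleRel_ore k).1).2.2.2.1

theorem actsBy_u21 : ActsBy (u21 k) (laurentMul k (0, 1, 0, 0)) := by
  refine ⟨oreGen k 3, ?_, (laurent_oreBaseRel k).lift_oreGen 3⟩
  rw [u21, map_add, map_mul, map_mul, oreRep_u2,
    show oreRep k (u1 k) = _ from (lift_generators (doubleRel_ore k).1).2.2.1]
  exact (doubleRel_ore k).2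

theorem actsBy_x21 : ActsBy (x21 k) (laurentMul k (1, 0, 0, 0)) := by
  have h : x1Op k * laurentX2 k + laurentX2 k * x1Op k = laurentMul k (1, 0, 0, 0) := by
    refine LinearMap.ext fun v => ?_
    simp only [LinearMap.add_apply, Module.End.mul_apply]
    ext1
    · simp [x1Op, x2Op]
    ext1
    · simp [x1Op, x2Op]
    ext1
    · simp [x1Op, x2Op]
    · simp [x1Op, x2Op]
  exact h ▸ (actsBy_x1.mul actsBy_x2).add (actsBy_x2.mul actsBy_x1)

theorem laurentMul_pow (m : LaurentExp) (n : ℕ) : laurentMul k m ^ n = laurentMul k (n • m) := by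
  rw [laurentMul, ← map_pow, single_pow, one_pow]

/-- The generator `g` as a unit. -/
noncomputable def gUnit (k : Type) [Field k] : (tD k)ˣ :=
  ⟨g k, gi k, (doubleRel_tD k).ggi, (doubleRel_tD k).gig⟩

theorem actsBy_gUnit_zpow (n : ℤ) :
    ActsBy (↑(gUnit k ^ n) : tD k) (laurentMul k (0, 0, 0, n)) := by
  obtain ⟨n, rfl | rfl⟩ := n.eq_nat_or_neg
  · have := (actsBy_g (k := k)).pow n
    rw [laurentMul_pow] at this
    simpa [gUnit] using this
  · have := (actsBy_gi (k := k)).pow n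
    rw [laurentMul_pow] at this
    have hg : (↑(gUnit k ^ (-n : ℤ)) : tD k) = gi k ^ n := by
      rw [zpow_neg, ← inv_zpow, zpow_natCast, Units.val_pow_eq_pow_val]; rfl
    rw [hg]
    simpa using this

theorem laurentSymbol_u2_pow (n : ℕ) :
    laurentSymbol k (u2 k ^ n) = Finsupp.single n (single 0 1, 0, 0, 0) := by
  have h : (oreRep k (u2 k ^ n)) (Finsupp.single 0 1) = Finsupp.single n 1 := by
    induction n with
    | zero => simp
    | succ n ih =>
      rw [pow_succ', map_mul, Module.End.mul_apply, ih, oreRep_u2, oreVar_single]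
      have h1 := oreMatrix_eq k (r := 1) ((map_one _).trans upperTri_one)
      rw [h1.1, h1.2, Finsupp.single_zero, add_zero]
  simp only [laurentSymbol, LinearMap.comp_apply, AlgHom.toLinearMap_apply,
    LinearMap.applyₗ_apply_apply, h, Finsupp.mapRange.linearMap_apply, Finsupp.mapRange_single,
    map_one]
  rfl

end Model

end SuperJordanDouble

namespace SuperJordanDouble

section Independence

open AddMonoidAlgebra

variable {k : Type} [Field k]

theorem aeval_laurentZ_apply (P Q : Polynomial k) :
    Polynomial.aeval (laurentZ k) P (single 0 Q, 0, 0, 0) = (single 0 (P * Q), 0, 0, 0) := by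
  have hX : ∀ Q : Polynomial k, laurentZ k (single 0 Q, 0, 0, 0) =
      (single 0 (Polynomial.X * Q), 0, 0, 0) := fun Q => by
    simp [zOp, eulerDerivation, gradingDerivation_single, single_mul_single]
  induction P using Polynomial.induction_on' generalizing Q with
  | add P P' h h' =>
    rw [map_add, LinearMap.add_apply, h, h', add_mul, single_add]
    simp
  | monomial n a =>
    rw [Polynomial.aeval_monomial]
    induction n generalizing Q with
    | zero =>
      simp only [pow_zero, mul_one, Polynomial.monomial_zero_left, Module.algebraMap_end_apply]
      rw [← Polynomial.smul_eq_C_mul]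
      simp [← smul_single]
    | succ n ih =>
      rw [pow_succ, ← mul_assoc, Module.End.mul_apply, hX, ih, ← mul_assoc,
        Polynomial.monomial_mul_X]

theorem laurentX2_pow_apply (n : ℕ) (P : Polynomial k) :
    (laurentX2 k ^ n) (single 0 P, 0, 0, 0) =
      (single ((0, 0, (n : ℤ), 0) : LaurentExp) P, 0, 0, 0) := by
  induction n with
  | zero => simp; rfl
  | succ n ih =>
    rw [pow_succ', Module.End.mul_apply, ih]
    simp [x2Op, shiftDerivation, lowerDerivation, gradingDerivation_single, single_mul_single,
      add_comm]

theorem laurentMul_apply (m n : LaurentExp) (P : Polynomial k) :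
    laurentMul k m (single n P, 0, 0, 0) = (single (m + n) P, 0, 0, 0) := by
  simp [laurentMul, single_mul_single]

/-- The four coordinate embeddings, indexed by the exponents of `x1` and `u1`. -/
def quadCoord {M : Type*} [Zero M] : Fin 2 → Fin 2 → M → M × M × M × M
  | 0, 0, v => (v, 0, 0, 0)
  | 1, 0, v => (0, v, 0, 0)
  | 0, 1, v => (0, 0, v, 0)
  | 1, 1, v => (0, 0, 0, v)

theorem op_pow_apply (a m : Fin 2) (v : LaurentRing k) :
    (x1Op k ^ (a : ℕ)) ((u1Op k ^ (m : ℕ)) (v, 0, 0, 0)) = quadCoord a m v := by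
  fin_cases a <;> fin_cases m <;> simp [x1Op, u1Op, quadCoord]

/-- Reordered monomials of `D~`, with a polynomial in `ζ`. -/
noncomputable def reorderedMonomial (a m : Fin 2) (b e c f : ℕ) (n : ℤ) (P : Polynomial k) : tD k :=
  x1 k ^ (a : ℕ) * (u1 k ^ (m : ℕ) * (x21 k ^ b * (u21 k ^ e * (↑(gUnit k ^ n) * (x2 k ^ c *
    (Polynomial.aeval (z k) P * u2 k ^ f))))))

theorem laurentSymbol_reorderedMonomial (a m : Fin 2) (b e c f : ℕ) (n : ℤ) (P : Polynomial k) :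
    laurentSymbol k (reorderedMonomial a m b e c f n P) =
      Finsupp.single f (quadCoord a m (single ((b, e, c, n) : LaurentExp) P)) := by
  have h1 := (actsBy_z.aeval P).laurentSymbol_mul_single (laurentSymbol_u2_pow f)
  rw [aeval_laurentZ_apply, mul_one] at h1
  have h2 := (actsBy_x2.pow c).laurentSymbol_mul_single h1
  rw [laurentX2_pow_apply] at h2
  have h3 := (actsBy_gUnit_zpow n).laurentSymbol_mul_single h2
  have h4 := (actsBy_u21.pow e).laurentSymbol_mul_single h3
  have h5 := (actsBy_x21.pow b).laurentSymbol_mul_single h4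
  rw [laurentMul_pow, laurentMul_pow, laurentMul_apply, laurentMul_apply, laurentMul_apply] at h5
  have h6 := (actsBy_x1.pow a).laurentSymbol_mul_single
    ((actsBy_u1.pow m).laurentSymbol_mul_single h5)
  rw [op_pow_apply] at h6
  rw [reorderedMonomial, h6]
  simp

theorem linearIndependent_single_prod {ι J M : Type*} [AddCommMonoid M] [Module k M] {w : J → M}
    (hw : LinearIndependent k w) :
    LinearIndependent k fun i : ι × J => Finsupp.single i.1 (w i.2) :=
  (Finsupp.linearIndependent_single (ι := ι) (φ := fun _ => J) (f := fun _ => w)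
    fun _ => hw).comp (Equiv.sigmaEquivProd ι J).symm (Equiv.injective _)

theorem linearIndependent_laurentSingle {Q : ℕ → Polynomial k} (hQ : LinearIndependent k Q) :
    LinearIndependent k fun i : LaurentExp × ℕ => (single i.1 (Q i.2) : LaurentRing k) :=
  .of_comp (coeffLinearEquiv k : LaurentRing k ≃ₗ[k] LaurentExp →₀ Polynomial k).toLinearMap
    (linearIndependent_single_prod hQ)

theorem linearIndependent_quadCoord {J M : Type*} [AddCommMonoid M] [Module k M] {w : J → M}
    (hw : LinearIndependent k w) :
    LinearIndependent k fun i : (Fin 2 × Fin 2) × J => quadCoord i.1.1 i.1.2 (w i.2) := by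
  let L : M × M × M × M →ₗ[k] Fin 2 × Fin 2 →₀ M :=
    LinearMap.coprod (Finsupp.lsingle (0, 0)) (LinearMap.coprod (Finsupp.lsingle (1, 0))
      (LinearMap.coprod (Finsupp.lsingle (0, 1)) (Finsupp.lsingle (1, 1))))
  have hL : ∀ (a m : Fin 2) (v : M), L (quadCoord a m v) = Finsupp.single (a, m) v := by
    intro a m v
    fin_cases a <;> fin_cases m <;> simp [L, quadCoord]
  refine .of_comp L ?_
  have e : L ∘ (fun i : (Fin 2 × Fin 2) × J => quadCoord i.1.1 i.1.2 (w i.2)) =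
      fun i => Finsupp.single i.1 (w i.2) := funext fun i => hL ..
  rw [e]
  exact linearIndependent_single_prod hw

theorem linearIndependent_reorderedMonomial {Q : ℕ → Polynomial k} (hQ : LinearIndependent k Q) :
    LinearIndependent k fun i : ℕ × (Fin 2 × Fin 2) × (ℕ × ℕ × ℕ × ℤ) × ℕ =>
      reorderedMonomial i.2.1.1 i.2.1.2 i.2.2.1.1 i.2.2.1.2.1 i.2.2.1.2.2.1 i.1 i.2.2.1.2.2.2
        (Q i.2.2.2) := by
  have h1 := linearIndependent_quadCoord (linearIndependent_laurentSingle hQ)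
  have h2 := (linearIndependent_single_prod (ι := ℕ) h1).comp
    (fun i : ℕ × (Fin 2 × Fin 2) × (ℕ × ℕ × ℕ × ℤ) × ℕ =>
      (i.1, i.2.1, (((i.2.2.1.1 : ℤ), (i.2.2.1.2.1 : ℤ), (i.2.2.1.2.2.1 : ℤ), i.2.2.1.2.2.2) :
        LaurentExp), i.2.2.2)) <| by
    rintro ⟨f, am, ⟨b, e, c, n⟩, N⟩ ⟨f', am', ⟨b', e', c', n'⟩, N'⟩ h
    simpa using h
  refine .of_comp (laurentSymbol k) ?_
  have e : laurentSymbol k ∘ (fun i : ℕ × (Fin 2 × Fin 2) × (ℕ × ℕ × ℕ × ℤ) × ℕ =>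
      reorderedMonomial i.2.1.1 i.2.1.2 i.2.2.1.1 i.2.2.1.2.1 i.2.2.1.2.2.1 i.1 i.2.2.1.2.2.2
        (Q i.2.2.2)) = _ := funext fun i => laurentSymbol_reorderedMonomial ..
  rw [e]
  exact h2

theorem linearIndependent_artinSchreier {p : ℕ} (hp : 1 < p) :
    LinearIndependent k fun N : ℕ =>
      ((Polynomial.X ^ p - Polynomial.X) ^ (N / p) * Polynomial.X ^ (N % p) : Polynomial k) := by
  have hd : (Polynomial.X ^ p - Polynomial.X : Polynomial k).degree = p := by
    rw [Polynomial.degree_sub_eq_left_of_degree_lt] <;> simp [hp]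
  let S : Polynomial.Sequence k :=
    ⟨fun N => (Polynomial.X ^ p - Polynomial.X) ^ (N / p) * Polynomial.X ^ (N % p), fun N => by
      rw [Polynomial.degree_mul, Polynomial.degree_pow, hd, Polynomial.degree_X_pow,
        nsmul_eq_mul]
      exact_mod_cast Nat.div_add_mod' N p⟩
  exact S.linearIndependent

end Independence

end SuperJordanDouble

section CentralSubalgebra

variable {k D : Type*} [Field k] [Ring D] [Algebra k D]

instance centerAlgebra : Algebra (Subalgebra.center k D) D where
  algebraMap := (Subalgebra.center k D).val
  commutes' c d := (Subalgebra.mem_center_iff.1 c.2 d).symm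
  smul_def' _ _ := rfl

/-- The central elements of a subalgebra, as a commutative algebra. -/
abbrev centralSubalgebra (A : Subalgebra k D) : Subalgebra k (Subalgebra.center k D) :=
  A.comap (Subalgebra.center k D).val

theorem sum_eq_zero_of_linearIndependent_mul {A : Subalgebra k D} {ι I : Type*} [Fintype I]
    {ζ : ι → D} {e : I → D} (hζ : Subalgebra.toSubmodule A ≤ Submodule.span k (Set.range ζ))
    (he : LinearIndependent k fun i : I × ι => ζ i.2 * e i.1) {c : I → D} (hc : ∀ i, c i ∈ A)
    (h : ∑ i, c i * e i = 0) (i : I) : c i = 0 := by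
  choose a ha using fun i => (Finsupp.mem_span_range_iff_exists_finsupp).1 (hζ (hc i))
  have h1 : ∀ i, c i * e i = Finsupp.linearCombination k (fun i : I × ι => ζ i.2 * e i.1)
      ((a i).mapDomain (Prod.mk i)) := fun i => by
    rw [Finsupp.linearCombination_mapDomain, ← ha, Finsupp.linearCombination_apply,
      Finsupp.sum, Finsupp.sum, Finset.sum_mul]
    simp only [Function.comp_apply, smul_mul_assoc]
  simp only [h1, ← map_sum] at h
  have h2 : a i = 0 := by
    ext m
    have := DFunLike.congr_fun (he (h.trans (map_zero _).symm)) (i, m)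
    rw [Finsupp.finsetSum_apply, Finset.sum_eq_single i, Finsupp.mapDomain_apply] at this
    · exact this
    · exact Prod.mk_right_injective i
    · intro j _ hj
      exact Finsupp.mapDomain_of_notMem_range _ _ fun ⟨n, hn⟩ => hj (congrArg Prod.fst hn)
    · simp
  rw [← ha i, h2, Finsupp.sum_zero_index]

/-- A finite spanning family over a central subalgebra `A` is a basis as soon as there is an
`A`-linearly independent family with the same indices. -/
theorem existsUnique_sum_of_span {A : Subalgebra k D} (hA : A ≤ Subalgebra.center k D)
    {I : Type*} [Fintype I] {m e : I → D}
    (hm : Submodule.span (centralSubalgebra A) (Set.range m) = ⊤)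
    (he : ∀ c : I → D, (∀ i, c i ∈ A) → ∑ i, c i * e i = 0 → ∀ i, c i = 0) (d : D) :
    ∃! c : I → A, d = ∑ i, (c i : D) * m i := by
  have hd : d ∈ Submodule.span (centralSubalgebra A) (Set.range m) := hm ▸ Submodule.mem_top
  obtain ⟨c, hc⟩ := (Submodule.mem_span_range_iff_exists_fun _).1 hd
  have : Module.Finite (centralSubalgebra A) D := ⟨⟨Set.range m |>.toFinite.toFinset, by simpa⟩⟩
  have hinj := OrzechProperty.injective_of_surjective_of_injective
    (Fintype.linearCombination (centralSubalgebra A) e)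
    (Fintype.linearCombination (centralSubalgebra A) m)
    ((injective_iff_map_eq_zero _).2 fun c hc => funext fun i => Subtype.ext (Subtype.ext
      (he (fun i => c i) (fun i => (c i).2) hc i)))
    (LinearMap.range_eq_top.1 ((Fintype.range_linearCombination _ _).trans hm))
  refine ⟨fun i => ⟨c i, (c i).2⟩, hc.symm, fun c' hc' => ?_⟩
  have h : (fun i => (⟨⟨c' i, hA (c' i).2⟩, (c' i).2⟩ : centralSubalgebra A)) = c :=
    hinj (hc'.symm.trans hc.symm)
  exact funext fun i => Subtype.ext (congrArg (fun c => ((c i : Subalgebra.center k D) : D)) h)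

end CentralSubalgebra

namespace DoubleRel

variable {k D : Type*} [Field k] [Ring D] [Algebra k D] {x1 x2 u1 u2 g gi z : D}

theorem span_centralSubalgebra_monomials_eq_top (h : DoubleRel x1 x2 u1 u2 g gi z) {p : ℕ}
    (hp : 1 < p) {A : Subalgebra k D} (hA : A ≤ Subalgebra.center k D)
    (hS : {(x1 * x2 + x2 * x1) ^ p, x2 ^ (2 * p), (u1 * u2 + u2 * u1) ^ p, u2 ^ (2 * p), g ^ p,
      gi ^ p, z ^ p - z} ⊆ (A : Set D))
    (htop : Algebra.adjoin k {x1, x2, u1, u2, g, gi, z} = ⊤) :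
    Submodule.span (centralSubalgebra A) (Set.range fun i : Fin 2 × Fin p × Fin (2 * p) × Fin p ×
        Fin p × Fin 2 × Fin p × Fin (2 * p) =>
      x1 ^ (i.1 : ℕ) * (x1 * x2 + x2 * x1) ^ (i.2.1 : ℕ) * x2 ^ (i.2.2.1 : ℕ) *
        g ^ (i.2.2.2.1 : ℕ) * z ^ (i.2.2.2.2.1 : ℕ) * u1 ^ (i.2.2.2.2.2.1 : ℕ) *
        (u1 * u2 + u2 * u1) ^ (i.2.2.2.2.2.2.1 : ℕ) * u2 ^ (i.2.2.2.2.2.2.2 : ℕ)) = ⊤ := by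
  have hp0 : 0 < p := by omega
  have scalar : ∀ {a b : D} {n : ℕ}, 0 < n → b ∈ (A : Set D) →
      b ∈ powSpan (centralSubalgebra A) a n := fun {a b n} hn hb =>
    algebraMap_mem_powSpan (R := centralSubalgebra A) (A := D) hn ⟨⟨b, hA hb⟩, hb⟩
  refine h.span_monomials_eq_top hp0 (scalar hp0 (hS (by simp))) (scalar (by omega) (hS (by simp)))
    (scalar hp0 (hS (by simp))) (scalar (by omega) (hS (by simp))) (scalar hp0 (hS (by simp))) ?_
    ?_ ?_
  · have h1 := pow_mem_powSpan (R := centralSubalgebra A) (a := z) hp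
    have h2 : z ^ p - z ∈ powSpan (centralSubalgebra A) z p := scalar hp0 (hS (by simp))
    simpa using add_mem h2 h1
  · have hgi : gi ^ p ∈ Algebra.adjoin (centralSubalgebra A) {g, z} := by
      have hm : gi ^ p ∈ (A : Set D) := hS (by simp)
      exact Subalgebra.algebraMap_mem _ (⟨⟨_, hA hm⟩, hm⟩ : centralSubalgebra A)
    have hg : g ∈ Algebra.adjoin (centralSubalgebra A) {g, z} :=
      Algebra.subset_adjoin (by simp)
    have heq : gi ^ p * g ^ (p - 1) = gi := by
      obtain ⟨n, rfl⟩ : ∃ n, p = n + 1 := ⟨p - 1, by omega⟩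
      have hc : Commute gi g := h.gig.trans h.ggi.symm
      rw [Nat.add_sub_cancel, pow_succ', mul_assoc, ← hc.mul_pow, h.gig, one_pow, mul_one]
    exact heq ▸ mul_mem hgi (pow_mem hg _)
  · refine _root_.eq_top_iff.2 fun d _ => ?_
    have hle : Algebra.adjoin k {x1, x2, u1, u2, g, gi, z} ≤ Subalgebra.restrictScalars k
        (Algebra.adjoin (centralSubalgebra A) {x1, x2, u1, u2, g, gi, z}) :=
      Algebra.adjoin_le Algebra.subset_adjoin
    exact hle (htop ▸ Algebra.mem_top)

theorem adjoin_central_le (h : DoubleRel x1 x2 u1 u2 g gi z) {p : ℕ} [CharP k p] (hp : p.Prime)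
    (hp2 : 2 < p) (htop : Algebra.adjoin k {x1, x2, u1, u2, g, gi, z} = ⊤) :
    Algebra.adjoin k {(x1 * x2 + x2 * x1) ^ p, x2 ^ (2 * p), (u1 * u2 + u2 * u1) ^ p,
      u2 ^ (2 * p), g ^ p, gi ^ p, z ^ p - z} ≤ Subalgebra.center k D := by
  have hD : (p : D) = 0 := by rw [← map_natCast (algebraMap k D), CharP.cast_eq_zero, map_zero]
  refine Algebra.adjoin_le fun a ha => Subalgebra.mem_center_iff.2 fun d => ?_
  have hd : d ∈ Algebra.adjoin k {x1, x2, u1, u2, g, gi, z} := htop ▸ Algebra.mem_top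
  induction hd using Algebra.adjoin_induction with
  | mem b hb => exact (h.commute_central hp hp2 hD ha hb).eq.symm
  | algebraMap c => exact Algebra.commutes c a
  | add b b' _ _ hb hb' => rw [add_mul, mul_add, hb, hb']
  | mul b b' _ _ hb hb' => rw [mul_assoc, hb', ← mul_assoc, hb, mul_assoc]

end DoubleRel

theorem add_mul_injective_of_lt {n : ℕ} {i j : Fin n} {a b : ℤ}
    (h : (i : ℤ) + n * a = j + n * b) : i = j ∧ a = b := by
  have hn : (n : ℤ) ≠ 0 := by exact_mod_cast i.pos.ne'
  have hij : (i : ℤ) = j := by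
    have := congrArg (· % (n : ℤ)) h
    simpa [Int.add_mul_emod_self_left, Int.emod_eq_of_lt, i.2, j.2] using this
  refine ⟨Fin.ext (by exact_mod_cast hij), ?_⟩
  rw [hij] at h
  exact mul_left_cancel₀ hn (add_left_cancel h)

theorem Nat.add_mul_injective_of_lt {n : ℕ} {i j : Fin n} {a b : ℕ}
    (h : (i : ℕ) + n * a = j + n * b) : i = j ∧ a = b := by
  have := _root_.add_mul_injective_of_lt (i := i) (j := j) (a := a) (b := b) (by exact_mod_cast h)
  exact ⟨this.1, by exact_mod_cast this.2⟩

theorem algebraMap_mul_factors {R D : Type*} [CommRing R] [Ring D] [Algebra R D]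
    (r1 r2 r3 r4 r5 r6 : R) (a b d1 d2 d3 d4 d5 d6 : D) :
    algebraMap R D (r1 * r2 * r3 * r4 * r5 * r6) *
        (a * (b * (d1 * (d3 * (d6 * (d2 * (d5 * d4))))))) =
      a * (b * (algebraMap R D r1 * d1 * (algebraMap R D r3 * d3 * (algebraMap R D r6 * d6 *
        (algebraMap R D r2 * d2 * (algebraMap R D r5 * d5 * (algebraMap R D r4 * d4))))))) := by
  simp only [← Algebra.smul_def, smul_mul_assoc, mul_smul_comm, smul_smul]
  congr 1
  ring

namespace SuperJordanDouble

open Polynomial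

variable {k : Type} [Field k]

theorem smul_reorderedMonomial {p : ℕ} {c1 c2 c3 c4 c5 c6 : Subalgebra.center k (tD k)}
    (h1 : (c1 : tD k) = x21 k ^ p) (h2 : (c2 : tD k) = x2 k ^ (2 * p))
    (h3 : (c3 : tD k) = u21 k ^ p) (h4 : (c4 : tD k) = u2 k ^ (2 * p))
    (h5 : (c5 : tD k) = z k ^ p - z k) {ν : ℤ} (h6 : (c6 : tD k) = ↑(gUnit k ^ (p * ν)))
    (α β γ ε φ : ℕ) (a m : Fin 2) (b e c f : ℕ) (n : ℤ) (P : k[X]) :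
    ((c1 ^ α * c2 ^ β * c3 ^ γ * c4 ^ ε * c5 ^ φ * c6 : Subalgebra.center k (tD k)) : tD k) *
        reorderedMonomial a m b e c f n P =
      reorderedMonomial a m (b + p * α) (e + p * γ) (c + 2 * p * β) (f + 2 * p * ε) (n + p * ν)
        ((X ^ p - X) ^ φ * P) := by
  have e1 : x21 k ^ (b + p * α) = ↑(c1 ^ α) * x21 k ^ b := by
    rw [add_comm, pow_add, pow_mul, ← h1]; rfl
  have e2 : x2 k ^ (c + 2 * p * β) = ↑(c2 ^ β) * x2 k ^ c := by
    rw [add_comm, pow_add, pow_mul, ← h2]; rfl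
  have e3 : u21 k ^ (e + p * γ) = ↑(c3 ^ γ) * u21 k ^ e := by
    rw [add_comm, pow_add, pow_mul, ← h3]; rfl
  have e4 : u2 k ^ (f + 2 * p * ε) = ↑(c4 ^ ε) * u2 k ^ f := by
    rw [add_comm, pow_add, pow_mul, ← h4]; rfl
  have e5 : aeval (z k) ((X ^ p - X) ^ φ * P) = ↑(c5 ^ φ) * aeval (z k) P := by
    rw [map_mul, map_pow, map_sub, map_pow, aeval_X, ← h5]; rfl
  have e6 : (↑(gUnit k ^ (n + p * ν)) : tD k) = c6 * (↑(gUnit k ^ n) : tD k) := by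
    rw [add_comm, zpow_add, Units.val_mul, ← h6]
  rw [reorderedMonomial, reorderedMonomial, e1, e2, e3, e4, e5, e6]
  exact algebraMap_mul_factors (D := tD k) (c1 ^ α) (c2 ^ β) (c3 ^ γ) (c4 ^ ε) (c5 ^ φ) c6 ..

/-- The monomials of `D~` in the order adapted to the Ore extension. -/
noncomputable def reorderedBasis (k : Type) [Field k] (p : ℕ) (i : Fin 2 × Fin p × Fin (2 * p) ×
    Fin p × Fin p × Fin 2 × Fin p × Fin (2 * p)) : tD k :=
  reorderedMonomial i.1 i.2.2.2.2.2.1 i.2.1 i.2.2.2.2.2.2.1 i.2.2.1 i.2.2.2.2.2.2.2 i.2.2.2.1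
    (X ^ (i.2.2.2.2.1 : ℕ))

theorem sum_mul_reorderedBasis_eq_zero {p : ℕ} (hp : 1 < p)
    (hZ : Zc k p ≤ Subalgebra.center k (tD k))
    {c : Fin 2 × Fin p × Fin (2 * p) × Fin p × Fin p × Fin 2 × Fin p × Fin (2 * p) → tD k}
    (hc : ∀ i, c i ∈ Zc k p) (h : ∑ i, c i * reorderedBasis k p i = 0) : ∀ i, c i = 0 := by
  have hmem : ∀ d ∈ _, d ∈ _ := fun d hd => hZ (Algebra.subset_adjoin (R := k) (A := tD k) (a := d) hd)
  let c1 : Subalgebra.center k (tD k) := ⟨x21 k ^ p, hmem _ (by simp)⟩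
  let c2 : Subalgebra.center k (tD k) := ⟨x2 k ^ (2 * p), hmem _ (by simp)⟩
  let c3 : Subalgebra.center k (tD k) := ⟨u21 k ^ p, hmem _ (by simp)⟩
  let c4 : Subalgebra.center k (tD k) := ⟨u2 k ^ (2 * p), hmem _ (by simp)⟩
  let c5 : Subalgebra.center k (tD k) := ⟨z k ^ p - z k, hmem _ (by simp)⟩
  let cg : (Subalgebra.center k (tD k))ˣ := ⟨⟨g k ^ p, hmem _ (by simp)⟩,
    ⟨gi k ^ p, hmem _ (by simp)⟩, Subtype.ext (congrArg Units.val (mul_inv_cancel (gUnit k ^ p))),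
    Subtype.ext (congrArg Units.val (inv_mul_cancel (gUnit k ^ p)))⟩
  have hcg : ∀ ν : ℤ, ((↑(cg ^ ν) : Subalgebra.center k (tD k)) : tD k) =
      ↑(gUnit k ^ (p * ν)) := fun ν => by
    have h1 : Units.map (Subalgebra.center k (tD k)).val.toMonoidHom cg = gUnit k ^ p :=
      Units.ext rfl
    rw [zpow_mul, zpow_natCast, ← h1, ← map_zpow]
    rfl
  let ζ : ℕ × ℕ × ℕ × ℕ × ℕ × ℤ → Subalgebra.center k (tD k) := fun m =>
    c1 ^ m.1 * c2 ^ m.2.1 * c3 ^ m.2.2.1 * c4 ^ m.2.2.2.1 * c5 ^ m.2.2.2.2.1 *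
      ↑(cg ^ m.2.2.2.2.2)
  refine sum_eq_zero_of_linearIndependent_mul (ζ := fun m => (ζ m : tD k)) ?_ ?_ hc h
  · refine adjoin_toSubmodule_le_of_mul_mem (Submodule.subset_span ⟨0, by simp [ζ]⟩) ?_
    intro d hd w hw
    have key : ∀ m, ∃ m', d * (ζ m : tD k) = ζ m' := by
      rintro ⟨α, β, γ, ε, φ, ν⟩
      simp only [Set.mem_insert_iff, Set.mem_singleton_iff] at hd
      rcases hd with rfl | rfl | rfl | rfl | rfl | rfl | rfl
      · exact ⟨(α + 1, β, γ, ε, φ, ν), congrArg Subtype.val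
          (show c1 * ζ (α, β, γ, ε, φ, ν) = _ by simp only [ζ]; ring)⟩
      · exact ⟨(α, β + 1, γ, ε, φ, ν), congrArg Subtype.val
          (show c2 * ζ (α, β, γ, ε, φ, ν) = _ by simp only [ζ]; ring)⟩
      · exact ⟨(α, β, γ + 1, ε, φ, ν), congrArg Subtype.val
          (show c3 * ζ (α, β, γ, ε, φ, ν) = _ by simp only [ζ]; ring)⟩
      · exact ⟨(α, β, γ, ε + 1, φ, ν), congrArg Subtype.val
          (show c4 * ζ (α, β, γ, ε, φ, ν) = _ by simp only [ζ]; ring)⟩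
      · exact ⟨(α, β, γ, ε, φ, ν + 1), congrArg Subtype.val
          (show cg * ζ (α, β, γ, ε, φ, ν) = _ by
            simp only [ζ, zpow_add_one, Units.val_mul]; ring)⟩
      · exact ⟨(α, β, γ, ε, φ, ν - 1), congrArg Subtype.val
          (show ↑cg⁻¹ * ζ (α, β, γ, ε, φ, ν) = _ by
            simp only [ζ, zpow_sub_one, Units.val_mul]; ring)⟩
      · exact ⟨(α, β, γ, ε, φ + 1, ν), congrArg Subtype.val
          (show c5 * ζ (α, β, γ, ε, φ, ν) = _ by simp only [ζ]; ring)⟩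
    induction hw using Submodule.span_induction with
    | mem w hw =>
      obtain ⟨m, rfl⟩ := hw
      obtain ⟨m', hm'⟩ := key m
      exact Submodule.subset_span ⟨m', hm'.symm⟩
    | zero => simp
    | add w w' _ _ h h' => rw [mul_add]; exact add_mem h h'
    | smul a w _ h => rw [mul_smul_comm]; exact Submodule.smul_mem _ a h
  · have hind := (linearIndependent_reorderedMonomial
      (linearIndependent_artinSchreier (k := k) hp)).comp
      (fun i : (Fin 2 × Fin p × Fin (2 * p) × Fin p × Fin p × Fin 2 × Fin p × Fin (2 * p)) ×
          ℕ × ℕ × ℕ × ℕ × ℕ × ℤ =>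
        ((i.1.2.2.2.2.2.2.2 + 2 * p * i.2.2.2.2.1, (i.1.1, i.1.2.2.2.2.2.1),
          (i.1.2.1 + p * i.2.1, i.1.2.2.2.2.2.2.1 + p * i.2.2.2.1, i.1.2.2.1 + 2 * p * i.2.2.1,
            i.1.2.2.2.1 + p * i.2.2.2.2.2.2), i.1.2.2.2.2.1 + p * i.2.2.2.2.2.1) :
          ℕ × (Fin 2 × Fin 2) × (ℕ × ℕ × ℕ × ℤ) × ℕ)) <| by
      rintro ⟨⟨n1, n21, n2, n, j, m1, m21, m2⟩, α, β, γ, ε, φ, ν⟩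
        ⟨⟨n1', n21', n2', n', j', m1', m21', m2'⟩, α', β', γ', ε', φ', ν'⟩ h
      simp only [Prod.mk.injEq] at h
      obtain ⟨h1, ⟨rfl, rfl⟩, ⟨h2, h3, h4, h5⟩, h6⟩ := h
      obtain ⟨rfl, rfl⟩ := Nat.add_mul_injective_of_lt h1
      obtain ⟨rfl, rfl⟩ := Nat.add_mul_injective_of_lt h2
      obtain ⟨rfl, rfl⟩ := Nat.add_mul_injective_of_lt h3
      obtain ⟨rfl, rfl⟩ := Nat.add_mul_injective_of_lt h4
      obtain ⟨rfl, rfl⟩ := add_mul_injective_of_lt h5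
      obtain ⟨rfl, rfl⟩ := Nat.add_mul_injective_of_lt h6
      rfl
    convert hind using 2 with i
    swap
    · rfl
    obtain ⟨⟨n1, n21, n2, n, j, m1, m21, m2⟩, α, β, γ, ε, φ, ν⟩ := i
    have hp0 : 0 < p := by omega
    simp only [Function.comp_apply, Nat.add_mul_div_left _ _ hp0, Nat.div_eq_of_lt j.2, zero_add,
      Nat.add_mul_mod_self_left, Nat.mod_eq_of_lt j.2]
    exact smul_reorderedMonomial rfl rfl rfl rfl rfl (hcg ν) ..

end SuperJordanDouble

/-- `D~` is a free module over its central subalgebra `Z` with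
basis the `16 p^6` PBW monomials
`x1^{n1} x21^{n21} x2^{n2} g^{n} ζ^{j} u1^{m1} u21^{m21} u2^{m2}`:
every element of `D~` is, in a unique way, a `Z`-linear combination of these monomials. -/
theorem superJordanDouble_free_over_center (p : ℕ) (hp : p.Prime) (hp2 : 2 < p)
    (k : Type) [Field k] [CharP k p] :
    Fintype.card (Fin 2 × Fin p × Fin (2 * p) × Fin p × Fin p × Fin 2 × Fin p × Fin (2 * p))
        = 16 * p ^ 6 ∧
    ∀ d : tD k,
      ∃! c : (Fin 2 × Fin p × Fin (2 * p) × Fin p × Fin p × Fin 2 × Fin p × Fin (2 * p)) →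
          Zc k p,
        d = Finset.sum Finset.univ fun i => (c i : tD k) * monoZ k p i := by
  have hle : Zc k p ≤ Subalgebra.center k (tD k) :=
    (doubleRel_tD k).adjoin_central_le hp hp2 (adjoin_generators_eq_top k)
  refine ⟨by simp only [Fintype.card_prod, Fintype.card_fin]; ring, fun d => ?_⟩
  exact existsUnique_sum_of_span hle ((doubleRel_tD k).span_centralSubalgebra_monomials_eq_top
    hp.one_lt hle Algebra.subset_adjoin (adjoin_generators_eq_top k))
    (fun _ hc h => sum_mul_reorderedBasis_eq_zero hp.one_lt hle hc h) d
end
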